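/- arXiv:1709.05985 — 4 statements merged into one kernel-verified Lean document; each statement's English description precedes it below -/
import Mathlib

section
/- Let k be an infinite field and let d ≥ 2. There exists a nonempty Zariski-open subset U of the affine space k^{3(d+1)} of coefficient triples such that for every triple (f₁, f₂, f₃) of homogeneous forms of degree d in R = k[x,y] whose coefficient vector lies in U, the ideal I = (f₁, f₂, f₃) has codimension 2 and its syzygy module (the kernel of the map R(-d)³ → I sending the basis elements to f₁, f₂, f₃) is minimally generated by two elements, of standard degrees ⌊d/2⌋ and ⌈d/2⌉ (equivalently, generated in degrees d + ⌊d/2⌋ and d + ⌈d/2⌉). -/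
open MvPolynomial

noncomputable section

/-- The binary form of degree `d` in `k[x,y]` with coefficient vector `c`
(`x := X 0`, `y := X 1`). -/
def formOf {k : Type*} [Field k] (d : ℕ) (c : Fin (d + 1) → k) :
    MvPolynomial (Fin 2) k :=
  ∑ l : Fin (d + 1), C (c l) * X 0 ^ (l : ℕ) * X 1 ^ (d - (l : ℕ))

/-- The map `R³ → R` sending `(a₁,a₂,a₃)` to `a₁f₁ + a₂f₂ + a₃f₃`; the syzygy
module of `(f₁,f₂,f₃)` is its kernel. -/
def syzMap {k : Type*} [Field k] (f : Fin 3 → MvPolynomial (Fin 2) k) :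
    (Fin 3 → MvPolynomial (Fin 2) k) →ₗ[MvPolynomial (Fin 2) k]
      MvPolynomial (Fin 2) k where
  toFun a := ∑ i, a i * f i
  map_add' a b := by
    simp [add_mul, Finset.sum_add_distrib]
  map_smul' r a := by
    simp [Finset.mul_sum, mul_assoc]

/-- The height (codimension) of an ideal: the infimum of the heights of the
primes containing it. -/
def idealHeight {A : Type*} [CommRing A] (I : Ideal A) : ℕ∞ :=
  ⨅ (P : PrimeSpectrum A) (_ : I ≤ P.asIdeal), Order.height P

/-- Injectivity of a linear map depending linearly on parameters is an open condition. -/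
lemma exists_polynomial_forall_injective {k σ V U : Type*} [Field k] [Fintype σ]
    [AddCommGroup V] [Module k V] [FiniteDimensional k V] [AddCommGroup U] [Module k U]
    (F : (σ → k) →ₗ[k] V →ₗ[k] U) (c₀ : σ → k) (h : Function.Injective (F c₀)) :
    ∃ P : MvPolynomial σ k, P ≠ 0 ∧ ∀ c, eval c P ≠ 0 → Function.Injective (F c) := by
  classical
  obtain ⟨L, hL⟩ := (F c₀).exists_leftInverse_of_injective (LinearMap.ker_eq_bot.2 h)
  let b := Module.finBasis k V
  let M : σ → Matrix _ _ k := fun s => LinearMap.toMatrix b b (L ∘ₗ F (Pi.single s 1))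
  have key : ∀ c, eval c (∑ s, (X s : MvPolynomial σ k) • (M s).map C).det =
      LinearMap.det (L ∘ₗ F c) := by
    intro c
    rw [RingHom.map_det, ← LinearMap.det_toMatrix b]
    congr 1
    have hc : F c = ∑ s, c s • F (Pi.single s 1) := by
      conv_lhs => rw [pi_eq_sum_univ' c]
      simp
    ext i j
    simp [hc, M, Matrix.sum_apply, LinearMap.toMatrix_apply]
  refine ⟨(∑ s, (X s : MvPolynomial σ k) • (M s).map C).det, fun h0 => ?_, fun c hc => ?_⟩
  · have := key c₀
    rw [h0, hL] at this
    simp at this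
  · rw [key] at hc
    have hinj : Function.Injective (L ∘ₗ F c) :=
      (LinearMap.equivOfDetNeZero (L ∘ₗ F c) hc).injective
    exact Function.Injective.of_comp (f := L) (by simpa using hinj)

section Forms

variable {k : Type*} [Field k]

lemma formOf_eq_sum_monomial (d : ℕ) (c : Fin (d + 1) → k) :
    formOf d c = ∑ l : Fin (d + 1),
      monomial (Finsupp.single 0 (l : ℕ) + Finsupp.single 1 (d - (l : ℕ))) (c l) := by
  refine Finset.sum_congr rfl fun l _ => ?_
  rw [X_pow_eq_monomial, X_pow_eq_monomial, C_mul_monomial, monomial_mul, mul_one, mul_one]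

lemma formOf_isHomogeneous (d : ℕ) (c : Fin (d + 1) → k) : (formOf d c).IsHomogeneous d := by
  rw [formOf_eq_sum_monomial]
  refine IsHomogeneous.sum _ _ _ fun l _ => isHomogeneous_monomial _ ?_
  simp only [map_add, Finsupp.degree_single]
  omega

lemma coeff_formOf (d : ℕ) (c : Fin (d + 1) → k) (l : Fin (d + 1)) :
    coeff (Finsupp.single 0 (l : ℕ) + Finsupp.single 1 (d - (l : ℕ))) (formOf d c) = c l := by
  rw [formOf_eq_sum_monomial, coeff_sum, Finset.sum_eq_single l]
  · simp
  · intro i _ hi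
    rw [coeff_monomial, if_neg]
    intro h
    have := DFunLike.congr_fun h 0
    simp at this
    exact hi (Fin.ext this)
  · simp

lemma formOf_single (d : ℕ) (l : Fin (d + 1)) :
    formOf d (Pi.single l (1 : k)) = X 0 ^ (l : ℕ) * X 1 ^ (d - (l : ℕ)) := by
  rw [formOf, Finset.sum_eq_single l]
  · simp
  · intro i _ hi
    simp [hi]
  · simp

lemma exists_eq_formOf {d : ℕ} {p : MvPolynomial (Fin 2) k} (hp : p.IsHomogeneous d) :
    ∃ c, formOf d c = p := by
  refine ⟨fun l => coeff (Finsupp.single 0 (l : ℕ) + Finsupp.single 1 (d - (l : ℕ))) p, ?_⟩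
  ext m
  by_cases hm : m.degree = d
  · have h2 : m 0 + m 1 = d := by simpa [Finsupp.degree_eq_sum] using hm
    have hme : m = Finsupp.single 0 (m 0) + Finsupp.single 1 (d - m 0) := by
      ext i
      fin_cases i <;> simp; omega
    have := coeff_formOf d
      (fun l => coeff (Finsupp.single 0 (l : ℕ) + Finsupp.single 1 (d - (l : ℕ))) p)
      ⟨m 0, by omega⟩
    simpa only [← hme] using this
  · rw [hp.coeff_eq_zero hm, (formOf_isHomogeneous d _).coeff_eq_zero hm]

/-- Binary forms of degree `d`, parametrised by their coefficients. -/
def formOfEquiv (k : Type*) [Field k] (d : ℕ) :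
    (Fin (d + 1) → k) ≃ₗ[k] homogeneousSubmodule (Fin 2) k d :=
  LinearEquiv.ofBijective
    { toFun := fun c => ⟨formOf d c, formOf_isHomogeneous d c⟩
      map_add' := fun a b => by
        ext1
        simp [formOf, add_mul, Finset.sum_add_distrib]
      map_smul' := fun r a => by
        ext1
        simp [formOf, Finset.smul_sum, smul_eq_C_mul, mul_assoc] }
    ⟨fun a b hab => by
        have h : formOf d a = formOf d b := congrArg Subtype.val hab
        funext l
        rw [← coeff_formOf d a l, h, coeff_formOf],
      fun p => by
        obtain ⟨c, hc⟩ := exists_eq_formOf p.2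
        exact ⟨c, Subtype.ext hc⟩⟩

instance (d : ℕ) : FiniteDimensional k (homogeneousSubmodule (Fin 2) k d) :=
  (formOfEquiv k d).finiteDimensional

lemma finrank_homogeneousSubmodule_fin_two (d : ℕ) :
    Module.finrank k (homogeneousSubmodule (Fin 2) k d) = d + 1 := by
  rw [← (formOfEquiv k d).finrank_eq]
  simp

/-- The map `(aᵢ) ↦ ∑ aᵢ fᵢ` on forms `aᵢ` of degree `n`. -/
def formsMulMap {κ : Type*} [Fintype κ] {d : ℕ} (n : ℕ) (f : κ → MvPolynomial (Fin 2) k)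
    (hf : ∀ i, (f i).IsHomogeneous d) :
    (κ → homogeneousSubmodule (Fin 2) k n) →ₗ[k] homogeneousSubmodule (Fin 2) k (n + d) where
  toFun a := ⟨∑ i, (a i : MvPolynomial (Fin 2) k) * f i,
    IsHomogeneous.sum _ _ _ fun i _ => (a i).2.mul (hf i)⟩
  map_add' a b := by
    ext1
    simp [add_mul, Finset.sum_add_distrib]
  map_smul' r a := by
    ext1
    simp [Finset.smul_sum]

/-- Absence of nonzero relations of degree `n` is an open condition. -/
lemma exists_polynomial_forall_no_relations {κ ι : Type*} [Fintype κ] [Fintype ι] (g : κ → ι)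
    (n d : ℕ) (c₀ : ι → Fin (d + 1) → k)
    (h : ∀ a : κ → MvPolynomial (Fin 2) k, (∀ i, (a i).IsHomogeneous n) →
      ∑ i, a i * formOf d (c₀ (g i)) = 0 → a = 0) :
    ∃ P : MvPolynomial (ι × Fin (d + 1)) k, P ≠ 0 ∧ ∀ c : ι → Fin (d + 1) → k,
      eval (fun p => c p.1 p.2) P ≠ 0 →
      ∀ a : κ → MvPolynomial (Fin 2) k, (∀ i, (a i).IsHomogeneous n) →
        ∑ i, a i * formOf d (c (g i)) = 0 → a = 0 := by
  let F : (ι × Fin (d + 1) → k) →ₗ[k] (κ → homogeneousSubmodule (Fin 2) k n) →ₗ[k]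
      MvPolynomial (Fin 2) k :=
    LinearMap.mk₂ k (fun c a => ∑ i, (a i : MvPolynomial (Fin 2) k) *
        formOfEquiv k d fun l => c (g i, l))
      (fun c c' a => by
        rw [← Finset.sum_add_distrib]
        refine Finset.sum_congr rfl fun i _ => ?_
        rw [← mul_add, ← Submodule.coe_add, ← map_add]
        rfl)
      (fun r c a => by
        rw [Finset.smul_sum]
        refine Finset.sum_congr rfl fun i _ => ?_
        rw [← mul_smul_comm, ← Submodule.coe_smul, ← map_smul]
        rfl)
      (fun c a b => by simp [add_mul, Finset.sum_add_distrib])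
      (fun r c a => by simp [Finset.smul_sum])
  have hF : ∀ c : ι → Fin (d + 1) → k, Function.Injective (F fun p => c p.1 p.2) ↔
      ∀ a : κ → MvPolynomial (Fin 2) k, (∀ i, (a i).IsHomogeneous n) →
        ∑ i, a i * formOf d (c (g i)) = 0 → a = 0 := by
    intro c
    rw [injective_iff_map_eq_zero]
    refine ⟨fun H a ha h0 => ?_, fun H a h0 => ?_⟩
    · have := H (fun i => ⟨a i, ha i⟩) h0
      funext i
      exact congrArg Subtype.val (congrFun this i)
    · have := H (fun i => a i) (fun i => (a i).2) h0
      funext i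
      exact Subtype.ext (congrFun this i)
  obtain ⟨P, hP, H⟩ := exists_polynomial_forall_injective F _ ((hF c₀).2 h)
  exact ⟨P, hP, fun c hc => (hF c).1 (H _ hc)⟩

lemma homogeneousComponent_mul_of_isHomogeneous {σ R : Type*} [CommSemiring R] {m : ℕ}
    {a : MvPolynomial σ R} (ha : a.IsHomogeneous m) (b : MvPolynomial σ R) (n : ℕ) :
    homogeneousComponent (n + m) (b * a) = homogeneousComponent n b * a := by
  classical
  conv_lhs => rw [← sum_homogeneousComponent b, Finset.sum_mul, map_sum]
  rw [Finset.sum_congr rfl fun i _ => homogeneousComponent_of_mem (m := n + m)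
    ((homogeneousComponent_isHomogeneous i b).mul ha)]
  simp only [add_left_inj]
  rw [Finset.sum_ite_eq]
  split_ifs with h
  · rfl
  · rw [homogeneousComponent_eq_zero _ _ (by simpa using h), zero_mul]

lemma eq_zero_of_dvd_of_isHomogeneous {σ : Type*} {m n : ℕ} {a b : MvPolynomial σ k}
    (ha : a.IsHomogeneous m) (hb : b.IsHomogeneous n) (h : b ∣ a) (hmn : m < n)
    (hb0 : b ≠ 0) : a = 0 := by
  by_contra ha0
  have := totalDegree_le_of_dvd_of_isDomain h ha0
  rw [ha.totalDegree ha0, hb.totalDegree hb0] at this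
  omega

lemma not_X_dvd_X_pow {i j : Fin 2} (h : i ≠ j) (n : ℕ) :
    ¬ (X i : MvPolynomial (Fin 2) k) ∣ X j ^ n := fun hd =>
  h (by simpa [X_dvd_X] using (X_prime (R := k) (i := i)).dvd_of_dvd_pow hd)

lemma X_pow_dvd_of_dvd_mul_X_pow {i j : Fin 2} (h : i ≠ j) {m n : ℕ} {a : MvPolynomial (Fin 2) k}
    (hd : X i ^ m ∣ a * X j ^ n) : X i ^ m ∣ a :=
  X_prime.pow_dvd_of_dvd_mul_right m (not_X_dvd_X_pow h n) hd

/-- Forms of the same degree without nonzero relations in degree `n` have no nonzero relations of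
degree at most `n`, homogeneous or not. -/
lemma eq_zero_of_totalDegree_le {κ : Type*} [Fintype κ] {d n : ℕ} {f : κ → MvPolynomial (Fin 2) k}
    (hf : ∀ i, (f i).IsHomogeneous d)
    (h : ∀ a : κ → MvPolynomial (Fin 2) k, (∀ i, (a i).IsHomogeneous n) →
      ∑ i, a i * f i = 0 → a = 0)
    {a : κ → MvPolynomial (Fin 2) k} (ha : ∀ i, (a i).totalDegree ≤ n)
    (h0 : ∑ i, a i * f i = 0) : a = 0 := by
  have hcomp : ∀ j ≤ n, ∀ i, homogeneousComponent j (a i) = 0 := by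
    intro j hj i
    have hz := h (fun i => X 0 ^ (n - j) * homogeneousComponent j (a i))
      (fun i => by
        have := (isHomogeneous_X_pow (R := k) (0 : Fin 2) (n - j)).mul
          (homogeneousComponent_isHomogeneous j (a i))
        rwa [Nat.sub_add_cancel hj] at this) (by
        have := congrArg (homogeneousComponent (j + d)) h0
        rw [map_sum, map_zero] at this
        simp_rw [homogeneousComponent_mul_of_isHomogeneous (hf _)] at this
        simp_rw [mul_assoc, ← Finset.mul_sum, this, mul_zero])
    have := congrFun hz i
    simpa using this
  funext i
  rw [← sum_homogeneousComponent (a i)]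
  refine Finset.sum_eq_zero fun j hj => hcomp j ?_ i
  have := Finset.mem_range.1 hj
  have := ha i
  omega

lemma no_relations_X_pow {d n : ℕ} (hn : n < d) (a : Fin 2 → MvPolynomial (Fin 2) k)
    (ha : ∀ i, (a i).IsHomogeneous n) (h : a 0 * X 0 ^ d + a 1 * X 1 ^ d = 0) : a = 0 := by
  have h1 : a 1 = 0 := by
    refine eq_zero_of_dvd_of_isHomogeneous (ha 1) (isHomogeneous_X_pow 0 d) ?_ hn (by simp)
    refine X_pow_dvd_of_dvd_mul_X_pow (j := 1) (n := d) (by simp) ⟨-a 0, ?_⟩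
    linear_combination h
  have h0 : a 0 = 0 := by simpa [h1] using h
  funext i
  fin_cases i <;> assumption

lemma no_relations_monomials {d e n : ℕ} (hn : n < e) (he : 2 * e ≤ d)
    (a : Fin 3 → MvPolynomial (Fin 2) k) (ha : ∀ i, (a i).IsHomogeneous n)
    (h : a 0 * X 0 ^ d + a 1 * X 1 ^ d + a 2 * (X 0 ^ e * X 1 ^ (d - e)) = 0) : a = 0 := by
  have h1 : a 1 = 0 := by
    refine eq_zero_of_dvd_of_isHomogeneous (ha 1) (isHomogeneous_X_pow 0 e) ?_ hn (by simp)
    refine X_pow_dvd_of_dvd_mul_X_pow (j := 1) (n := d) (by simp)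
      ⟨-a 0 * X 0 ^ (d - e) - a 2 * X 1 ^ (d - e), ?_⟩
    have : (X 0 : MvPolynomial (Fin 2) k) ^ d = X 0 ^ e * X 0 ^ (d - e) := by
      rw [← pow_add]
      congr 1
      omega
    rw [this] at h
    linear_combination h
  have h0 : a 0 = 0 := by
    refine eq_zero_of_dvd_of_isHomogeneous (ha 0) (isHomogeneous_X_pow 1 (d - e)) ?_
      (by omega) (by simp)
    refine X_pow_dvd_of_dvd_mul_X_pow (j := 0) (n := d) (by simp) ⟨-a 2 * X 0 ^ e, ?_⟩
    rw [h1] at h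
    linear_combination h
  have h2 : a 2 = 0 := by simpa [h0, h1] using h
  funext i
  fin_cases i <;> assumption

/-- Two forms of degree `d` without relations in degree `d - 1` generate all forms of
degree `2 * d - 1`. -/
lemma mem_span_of_no_relations {d : ℕ} (hd : 1 ≤ d) {f : Fin 2 → MvPolynomial (Fin 2) k}
    (hf : ∀ i, (f i).IsHomogeneous d)
    (h : ∀ a : Fin 2 → MvPolynomial (Fin 2) k, (∀ i, (a i).IsHomogeneous (d - 1)) →
      ∑ i, a i * f i = 0 → a = 0)
    {p : MvPolynomial (Fin 2) k} (hp : p.IsHomogeneous (d - 1 + d)) :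
    ∃ a b, a * f 0 + b * f 1 = p := by
  have hinj : Function.Injective (formsMulMap (d - 1) f hf) := by
    rw [injective_iff_map_eq_zero]
    intro a h0
    have := h (fun i => a i) (fun i => (a i).2) (congrArg Subtype.val h0)
    funext i
    exact Subtype.ext (congrFun this i)
  have hdim : Module.finrank k (Fin 2 → homogeneousSubmodule (Fin 2) k (d - 1)) =
      Module.finrank k (homogeneousSubmodule (Fin 2) k (d - 1 + d)) := by
    rw [Module.finrank_pi_fintype]
    simp only [finrank_homogeneousSubmodule_fin_two]
    simp
    omega
  obtain ⟨a, ha⟩ := (LinearMap.injective_iff_surjective_of_finrank_eq_finrank hdim).1 hinj ⟨p, hp⟩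
  refine ⟨a 0, a 1, ?_⟩
  simpa [formsMulMap] using congrArg Subtype.val ha

/-- An ideal of `k[x,y]` contained in `(x,y)` and containing powers of `x` and `y` has height 2. -/
lemma idealHeight_eq_two {I : Ideal (MvPolynomial (Fin 2) k)} {N : ℕ}
    (hX : ∀ i, X i ^ N ∈ I) (hI : ∀ p ∈ I, constantCoeff p = 0) : idealHeight I = 2 := by
  apply le_antisymm
  · let P : PrimeSpectrum (MvPolynomial (Fin 2) k) :=
      ⟨RingHom.ker (constantCoeff (σ := Fin 2) (R := k)), RingHom.ker_isPrime _⟩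
    refine (iInf₂_le P fun p hp => hI p hp).trans ?_
    have h1 : ((Order.height P : ℕ∞) : WithBot ℕ∞) ≤ ringKrullDim (MvPolynomial (Fin 2) k) :=
      Order.height_le_krullDim _
    rw [MvPolynomial.ringKrullDim_of_isNoetherianRing, ringKrullDim_eq_zero_of_field] at h1
    simp only [Nat.card_eq_fintype_card, Fintype.card_fin, zero_add] at h1
    exact WithBot.coe_le_coe.1 h1
  · refine le_iInf₂ fun P hP => ?_
    have hmem : ∀ i, (X i : MvPolynomial (Fin 2) k) ∈ P.asIdeal := fun i =>
      P.isPrime.mem_of_pow_mem N (hP (hX i))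
    let Q : PrimeSpectrum (MvPolynomial (Fin 2) k) :=
      ⟨Ideal.span {X 0}, (Ideal.span_singleton_prime (X_ne_zero 0)).2 X_prime⟩
    have hQP : Q < P := by
      refine lt_of_le_of_ne ?_ ?_
      · change Ideal.span {X 0} ≤ P.asIdeal
        rw [Ideal.span_singleton_le_iff_mem]
        exact hmem 0
      · intro h
        have : (X 1 : MvPolynomial (Fin 2) k) ∈ Q.asIdeal := h ▸ hmem 1
        rw [Ideal.mem_span_singleton, X_dvd_X] at this
        exact absurd this (by simp)
    have hbQ : (⊥ : PrimeSpectrum (MvPolynomial (Fin 2) k)) < Q := by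
      rw [bot_lt_iff_ne_bot]
      intro h
      have : (X 0 : MvPolynomial (Fin 2) k) ∈
          (⊥ : PrimeSpectrum (MvPolynomial (Fin 2) k)).asIdeal :=
        h ▸ Ideal.mem_span_singleton_self _
      simp at this
    calc (2 : ℕ∞) = 0 + 1 + 1 := by norm_num
      _ ≤ Order.height (⊥ : PrimeSpectrum (MvPolynomial (Fin 2) k)) + 1 + 1 := by gcongr; simp
      _ ≤ Order.height Q + 1 := by gcongr; exact Order.height_add_one_le hbQ
      _ ≤ Order.height P := Order.height_add_one_le hQP

section CrossProduct

variable {R : Type*} [CommRing R]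

lemma crossProduct_eq_zero_iff (v w : Fin 3 → R) :
    crossProduct v w = 0 ↔ ∀ i j, v i * w j = v j * w i := by
  rw [cross_apply]
  constructor
  · intro h
    have h0 := congrFun h 0
    have h1 := congrFun h 1
    have h2 := congrFun h 2
    simp at h0 h1 h2
    intro i j
    fin_cases i <;> fin_cases j <;> simp <;> grind
  · intro h
    funext i
    fin_cases i <;> simp <;> grind

lemma eq_zero_of_crossProduct_eq_zero [IsDomain R] {u v w : Fin 3 → R}
    (hv : crossProduct u v = 0) (hw : crossProduct u w = 0) (hvw : crossProduct v w ≠ 0) :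
    u = 0 := by
  rw [crossProduct_eq_zero_iff] at hv hw
  rw [Ne, crossProduct_eq_zero_iff] at hvw
  push Not at hvw
  obtain ⟨j, l, hjl⟩ := hvw
  funext i
  have : u i * u i * (v j * w l - v l * w j) = 0 := by
    linear_combination (u i * w l) * hv i j + (u j * v i) * hw i l - (u i * w j) * hv i l
      - (u l * v i) * hw i j
  simpa [sub_eq_zero, hjl] using this

/-- The cross product of two syzygies of `f` is proportional to `f`. -/
lemma exists_crossProduct_eq_smul [IsDomain R] [DecompositionMonoid R] {f s t : Fin 3 → R}
    (hf : IsRelPrime (f 0) (f 1)) (hf0 : f 0 ≠ 0) (hs : ∑ i, s i * f i = 0)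
    (ht : ∑ i, t i * f i = 0) : ∃ l : R, crossProduct s t = l • f := by
  rw [Fin.sum_univ_three] at hs ht
  have h01 : (s 1 * t 2 - s 2 * t 1) * f 1 = (s 2 * t 0 - s 0 * t 2) * f 0 := by
    linear_combination t 2 * hs - s 2 * ht
  have h02 : (s 1 * t 2 - s 2 * t 1) * f 2 = (s 0 * t 1 - s 1 * t 0) * f 0 := by
    linear_combination -t 1 * hs + s 1 * ht
  obtain ⟨l, hl⟩ := hf.dvd_of_dvd_mul_right ⟨_, h01.trans (mul_comm _ _)⟩
  refine ⟨l, ?_⟩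
  have h1 : s 2 * t 0 - s 0 * t 2 = l * f 1 := by
    apply mul_right_cancel₀ hf0
    rw [← h01, hl]
    ring
  have h2 : s 0 * t 1 - s 1 * t 0 = l * f 2 := by
    apply mul_right_cancel₀ hf0
    rw [← h02, hl]
    ring
  rw [cross_apply, h1, h2, hl, mul_comm]
  funext i
  fin_cases i <;> simp

/-- Two syzygies of `f` whose cross product is a unit multiple of `f` generate all syzygies. -/
lemma exists_eq_smul_add_smul [IsDomain R] [DecompositionMonoid R] {f s t u : Fin 3 → R}
    (hf : IsRelPrime (f 0) (f 1)) (hf0 : f 0 ≠ 0) {r : R} (hr : IsUnit r)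
    (hst : crossProduct s t = r • f) (hs : ∑ i, s i * f i = 0) (ht : ∑ i, t i * f i = 0)
    (hu : ∑ i, u i * f i = 0) : ∃ a b : R, a • s + b • t = u := by
  obtain ⟨μ, hμ⟩ := exists_crossProduct_eq_smul hf hf0 hu hs
  obtain ⟨ν, hν⟩ := exists_crossProduct_eq_smul hf hf0 hu ht
  have hts : crossProduct t s = -(r • f) := by rw [← hst, cross_anticomm]
  have hw : r • u - ν • s + μ • t = 0 := by
    refine eq_zero_of_crossProduct_eq_zero (v := s) (w := t) ?_ ?_ ?_
    · simp only [map_add, map_sub, map_smul, LinearMap.add_apply, LinearMap.sub_apply,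
        LinearMap.smul_apply, hμ, hts, cross_self]
      module
    · simp only [map_add, map_sub, map_smul, LinearMap.add_apply, LinearMap.sub_apply,
        LinearMap.smul_apply, hν, hst, cross_self]
      module
    · intro h
      have := congrFun (hst.symm.trans h) 0
      simp [hr.ne_zero, hf0] at this
  obtain ⟨v, hv⟩ := hr.exists_left_inv
  refine ⟨v * ν, -(v * μ), ?_⟩
  have : u = (v * r) • u := by rw [hv, one_smul]
  rw [this, ← sub_eq_zero]
  calc _ = -v • (r • u - ν • s + μ • t) := by module
    _ = 0 := by rw [hw, smul_zero]

end CrossProduct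

/-- A nonzero syzygy of minimal degree and a homogeneous syzygy that is not a multiple of it are
linearly independent. -/
lemma crossProduct_ne_zero_of_minimal {e m : ℕ} (he : 0 < e)
    {f s t : Fin 3 → MvPolynomial (Fin 2) k}
    (hmin : ∀ a : Fin 3 → MvPolynomial (Fin 2) k, (∀ i, (a i).totalDegree < e) →
      ∑ i, a i * f i = 0 → a = 0)
    (hs : ∀ i, (s i).IsHomogeneous e) (hs0 : s ≠ 0) (hsf : ∑ i, s i * f i = 0)
    (ht : ∀ i, (t i).IsHomogeneous (m + e))
    (hst : ∀ h : MvPolynomial (Fin 2) k, h.IsHomogeneous m → h • s ≠ t) :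
    crossProduct s t ≠ 0 := by
  intro hc
  rw [crossProduct_eq_zero_iff] at hc
  obtain ⟨i₀, hi₀⟩ := Function.ne_iff.1 hs0
  obtain ⟨q, p, c, hqp, hq, hp⟩ :=
    UniqueFactorizationMonoid.exists_reduced_factors (s i₀) hi₀ (t i₀)
  have hc0 : c ≠ 0 := by
    rintro rfl
    exact hi₀ (by simpa using hq.symm)
  have hq0 : q ≠ 0 := by
    rintro rfl
    exact hi₀ (by simpa using hq.symm)
  have hqt : ∀ j, q * t j = s j * p := by
    intro j
    apply mul_left_cancel₀ hc0
    linear_combination hc i₀ j + t j * hq - s j * hp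
  choose τ hτ using fun j => hqp.dvd_of_dvd_mul_right ⟨t j, (hqt j).symm⟩
  have hτf : ∑ i, τ i * f i = 0 := by
    apply mul_left_cancel₀ hq0
    rw [mul_zero, ← hsf, Finset.mul_sum]
    exact Finset.sum_congr rfl fun i _ => by rw [hτ i, mul_assoc]
  have hτ0 : τ ≠ 0 := fun h => hi₀ (by simp [hτ, h])
  have hqdeg : q.totalDegree = 0 := by
    by_contra hne
    refine hτ0 (hmin τ (fun i => ?_) hτf)
    by_cases hi : τ i = 0
    · simpa [hi] using he
    · have h1 := (hs i).totalDegree (by rw [hτ i]; exact mul_ne_zero hq0 hi)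
      rw [hτ i, totalDegree_mul_of_isDomain hq0 hi] at h1
      omega
  obtain ⟨r, hr⟩ : ∃ r, q = C r := ⟨_, totalDegree_eq_zero_iff_eq_C.1 hqdeg⟩
  have hr0 : r ≠ 0 := by
    rintro rfl
    exact hq0 (by simp [hr])
  refine hst (homogeneousComponent m (C r⁻¹ * p)) (homogeneousComponent_isHomogeneous _ _) ?_
  funext j
  rw [Pi.smul_apply, smul_eq_mul, ← homogeneousComponent_mul_of_isHomogeneous (hs j)]
  have : C r⁻¹ * p * s j = t j := by
    rw [mul_assoc, mul_comm p, ← hqt j, hr, ← mul_assoc, ← C_mul, inv_mul_cancel₀ hr0, C_1, one_mul]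
  rw [this, homogeneousComponent_eq_self (ht j)]

lemma exists_syzygy_ne_zero {d n : ℕ} {f : Fin 3 → MvPolynomial (Fin 2) k}
    (hf : ∀ i, (f i).IsHomogeneous d) (hn : d < 2 * n + 2) :
    ∃ s : Fin 3 → MvPolynomial (Fin 2) k, (∀ i, (s i).IsHomogeneous n) ∧ s ≠ 0 ∧
      ∑ i, s i * f i = 0 := by
  have hker : LinearMap.ker (formsMulMap n f hf) ≠ ⊥ := by
    apply LinearMap.ker_ne_bot_of_finrank_lt
    rw [Module.finrank_pi_fintype]
    simp only [finrank_homogeneousSubmodule_fin_two]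
    simp
    omega
  obtain ⟨s, hs, hs0⟩ := Submodule.exists_mem_ne_zero_of_ne_bot hker
  refine ⟨fun i => s i, fun i => (s i).2, fun h => hs0 ?_, congrArg Subtype.val hs⟩
  funext i
  exact Subtype.ext (congrFun h i)

/-- In degree `m + e` with `d = m + 2 * e` there are more syzygies than multiples of a given syzygy
of degree `e`. -/
lemma exists_syzygy_not_multiple {d e m : ℕ} {f s : Fin 3 → MvPolynomial (Fin 2) k}
    (hf : ∀ i, (f i).IsHomogeneous d) (hs : ∀ i, (s i).IsHomogeneous e) (hd : d = m + 2 * e) :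
    ∃ t : Fin 3 → MvPolynomial (Fin 2) k, (∀ i, (t i).IsHomogeneous (m + e)) ∧
      (∀ h : MvPolynomial (Fin 2) k, h.IsHomogeneous m → h • s ≠ t) ∧ ∑ i, t i * f i = 0 := by
  let T : homogeneousSubmodule (Fin 2) k m →ₗ[k]
      (Fin 3 → homogeneousSubmodule (Fin 2) k (m + e)) :=
    { toFun := fun h i => ⟨h * s i, IsHomogeneous.mul h.2 (hs i)⟩
      map_add' := fun a b => by
        ext1 i
        ext1
        simp [add_mul]
      map_smul' := fun r a => by
        ext1 i
        ext1
        simp }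
  have hnot : ¬ LinearMap.ker (formsMulMap (m + e) f hf) ≤ LinearMap.range T := by
    intro hle
    have h1 := Submodule.finrank_mono hle
    have h2 := T.finrank_range_le
    have h3 := (formsMulMap (m + e) f hf).finrank_range_add_finrank_ker
    have h4 := (LinearMap.range (formsMulMap (m + e) f hf)).finrank_le
    rw [Module.finrank_pi_fintype] at h3
    simp only [finrank_homogeneousSubmodule_fin_two] at h2 h3 h4
    simp at h3
    omega
  obtain ⟨t, ht, htT⟩ := SetLike.not_le_iff_exists.1 hnot
  refine ⟨fun i => t i, fun i => (t i).2, fun h hh hst => htT ⟨⟨h, hh⟩, ?_⟩,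
    congrArg Subtype.val ht⟩
  funext i
  exact Subtype.ext (congrFun hst i)

lemma isHomogeneous_crossProduct {m n : ℕ} {s t : Fin 3 → MvPolynomial (Fin 2) k}
    (hs : ∀ i, (s i).IsHomogeneous m) (ht : ∀ i, (t i).IsHomogeneous n) (i : Fin 3) :
    (crossProduct s t i).IsHomogeneous (m + n) := by
  rw [cross_apply]
  fin_cases i
  exacts [((hs 1).mul (ht 2)).sub ((hs 2).mul (ht 1)), ((hs 2).mul (ht 0)).sub ((hs 0).mul (ht 2)),
    ((hs 0).mul (ht 1)).sub ((hs 1).mul (ht 0))]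

lemma isRelPrime_of_dvd_X_pow {f g : MvPolynomial (Fin 2) k} {N : ℕ}
    (h : ∀ i : Fin 2, ∃ a b, a * f + b * g = X i ^ N) : IsRelPrime f g := by
  intro p hpf hpg
  have hp : ∀ i : Fin 2, p ∣ X i ^ N := by
    intro i
    obtain ⟨a, b, hab⟩ := h i
    exact hab ▸ dvd_add (hpf.mul_left a) (hpg.mul_left b)
  obtain ⟨j, -, hj⟩ := (dvd_prime_pow (X_prime (i := (0 : Fin 2))) N).1 (hp 0)
  have h0 : j = 0 := by
    by_contra hne
    exact not_X_dvd_X_pow (k := k) (i := 0) (j := 1) (by simp) N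
      ((dvd_pow_self _ hne).trans (hj.symm.dvd.trans (hp 1)))
  rw [h0, pow_zero] at hj
  exact associated_one_iff_isUnit.1 hj

/-- Minimal generators of the syzygies of three forms, the first two of which are coprime, that have
no syzygy of degree less than `d / 2`. -/
lemma exists_minimal_syzygies {d e m : ℕ} (he : 0 < e) (hd : d = m + 2 * e) (hm : m < 2)
    {f : Fin 3 → MvPolynomial (Fin 2) k} (hf : ∀ i, (f i).IsHomogeneous d)
    (hrel : IsRelPrime (f 0) (f 1)) (hf0 : f 0 ≠ 0)
    (hmin : ∀ a : Fin 3 → MvPolynomial (Fin 2) k, (∀ i, (a i).totalDegree < e) →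
      ∑ i, a i * f i = 0 → a = 0) :
    ∃ s₁ s₂ : Fin 3 → MvPolynomial (Fin 2) k,
      (∀ i, (s₁ i).IsHomogeneous e) ∧ (∀ i, (s₂ i).IsHomogeneous (m + e)) ∧
      Submodule.span (MvPolynomial (Fin 2) k) {s₁, s₂} = LinearMap.ker (syzMap f) ∧
      ¬ ∃ s : Fin 3 → MvPolynomial (Fin 2) k,
        Submodule.span (MvPolynomial (Fin 2) k) {s} = LinearMap.ker (syzMap f) := by
  obtain ⟨s, hs, hs0, hsf⟩ := exists_syzygy_ne_zero hf (n := e) (by omega)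
  obtain ⟨t, ht, hst, htf⟩ := exists_syzygy_not_multiple hf hs hd
  have hc := crossProduct_ne_zero_of_minimal he hmin hs hs0 hsf ht hst
  obtain ⟨l, hl⟩ := exists_crossProduct_eq_smul hrel hf0 hsf htf
  have hl0 : l ≠ 0 := by
    rintro rfl
    exact hc (by simpa using hl)
  have hldeg : l.totalDegree = 0 := by
    have h1 := isHomogeneous_crossProduct hs ht 0
    rw [hl, Pi.smul_apply, smul_eq_mul] at h1
    have h2 := h1.totalDegree (mul_ne_zero hl0 hf0)
    rw [totalDegree_mul_of_isDomain hl0 hf0, (hf 0).totalDegree hf0] at h2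
    omega
  have hlu : IsUnit l := by
    rw [totalDegree_eq_zero_iff_eq_C.1 hldeg] at hl0 ⊢
    exact (isUnit_iff_ne_zero.2 fun h => hl0 (by rw [h, C_0])).map C
  have hker : ∀ u, u ∈ LinearMap.ker (syzMap f) ↔ ∑ i, u i * f i = 0 := fun u => Iff.rfl
  refine ⟨s, t, hs, ht, le_antisymm ?_ fun u hu => ?_, ?_⟩
  · rw [Submodule.span_le, Set.pair_subset_iff]
    exact ⟨hsf, htf⟩
  · exact Submodule.mem_span_pair.2 (exists_eq_smul_add_smul hrel hf0 hlu hl hsf htf hu)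
  · rintro ⟨u, hu⟩
    obtain ⟨a, rfl⟩ := Submodule.mem_span_singleton.1 (hu ▸ (hker s).2 hsf)
    obtain ⟨b, rfl⟩ := Submodule.mem_span_singleton.1 (hu ▸ (hker t).2 htf)
    exact hc (by simp)

end Forms

/-- For an infinite field `k` and `d ≥ 2`, for general forms `f₁, f₂, f₃` of degree `d`
in `k[x,y]` (i.e. on a nonempty Zariski-open set of the parameter space `k^{3(d+1)}`
of coefficients, here encoded as the nonvanishing locus of a nonzero polynomial `P`),
the ideal `I = (f₁,f₂,f₃)` has codimension 2 and the syzygy module of `(f₁,f₂,f₃)`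
is minimally generated by two elements, of standard degrees `⌊d/2⌋` and `⌈d/2⌉`. -/
theorem general_binary_forms_syzygies (k : Type*) [Field k] [Infinite k]
    (d : ℕ) (hd : 2 ≤ d) :
    ∃ P : MvPolynomial (Fin 3 × Fin (d + 1)) k, P ≠ 0 ∧
      ∀ c : Fin 3 → Fin (d + 1) → k,
        eval (fun p => c p.1 p.2) P ≠ 0 →
          idealHeight (Ideal.span {formOf d (c 0), formOf d (c 1), formOf d (c 2)}) = 2 ∧
          ∃ s₁ s₂ : Fin 3 → MvPolynomial (Fin 2) k,
            (∀ i, (s₁ i).IsHomogeneous (d / 2)) ∧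
            (∀ i, (s₂ i).IsHomogeneous ((d + 1) / 2)) ∧
            Submodule.span (MvPolynomial (Fin 2) k) {s₁, s₂} =
              LinearMap.ker (syzMap fun j => formOf d (c j)) ∧
            ¬ ∃ s : Fin 3 → MvPolynomial (Fin 2) k,
                Submodule.span (MvPolynomial (Fin 2) k) {s} =
                  LinearMap.ker (syzMap fun j => formOf d (c j)) := by
  set e := d / 2 with he
  have hcA : ∀ a : Fin 2 → MvPolynomial (Fin 2) k, (∀ i, (a i).IsHomogeneous (d - 1)) →
      ∑ i, a i * formOf d ((![Pi.single (Fin.last d) 1, Pi.single 0 1,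
        Pi.single ⟨e, by omega⟩ 1] : Fin 3 → Fin (d + 1) → k) (Fin.castSucc i)) = 0 → a = 0 := by
    intro a ha h
    refine no_relations_X_pow (d := d) (by omega) a ha ?_
    simpa [Fin.sum_univ_two, formOf_single] using h
  have hcB : ∀ a : Fin 3 → MvPolynomial (Fin 2) k, (∀ i, (a i).IsHomogeneous (e - 1)) →
      ∑ i, a i * formOf d ((![Pi.single (Fin.last d) 1, Pi.single 0 1,
        Pi.single ⟨e, by omega⟩ 1] : Fin 3 → Fin (d + 1) → k) (id i)) = 0 → a = 0 := by
    intro a ha h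
    refine no_relations_monomials (d := d) (e := e) (by omega) (by omega) a ha ?_
    simpa [Fin.sum_univ_three, formOf_single] using h
  obtain ⟨P, hP, hPc⟩ := exists_polynomial_forall_no_relations _ _ d _ hcA
  obtain ⟨Q, hQ, hQc⟩ := exists_polynomial_forall_no_relations _ _ d _ hcB
  refine ⟨P * Q, mul_ne_zero hP hQ, fun c hc => ?_⟩
  rw [map_mul] at hc
  have hA := hPc c (left_ne_zero_of_mul hc)
  have hB := hQc c (right_ne_zero_of_mul hc)
  have hf : ∀ i, (formOf d (c i)).IsHomogeneous d := fun i => formOf_isHomogeneous d _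
  have hX : ∀ i : Fin 2, ∃ a b, a * formOf d (c 0) + b * formOf d (c 1) =
      (X i : MvPolynomial (Fin 2) k) ^ (d - 1 + d) := fun i =>
    mem_span_of_no_relations (by omega) (fun i => hf (Fin.castSucc i)) hA (isHomogeneous_X_pow i _)
  have hf0 : formOf d (c 0) ≠ 0 := by
    intro h0
    have := congrFun (hA ![X 0 ^ (d - 1), 0] (by
      intro i
      fin_cases i
      exacts [isHomogeneous_X_pow 0 _, isHomogeneous_zero _ _ _]) (by simp [h0])) 0
    simp at this
  refine ⟨idealHeight_eq_two (N := d - 1 + d) (fun i => ?_) fun p hp => ?_, ?_⟩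
  · obtain ⟨a, b, hab⟩ := hX i
    rw [← hab]
    exact add_mem (Ideal.mul_mem_left _ _ (Ideal.subset_span (by simp)))
      (Ideal.mul_mem_left _ _ (Ideal.subset_span (by simp)))
  · have hle : Ideal.span {formOf d (c 0), formOf d (c 1), formOf d (c 2)} ≤
        RingHom.ker (constantCoeff (σ := Fin 2) (R := k)) := by
      have h0 : ∀ i, constantCoeff (formOf d (c i)) = 0 := fun i =>
        (hf i).coeff_eq_zero (by simp; omega)
      rw [Ideal.span_le]
      rintro _ (rfl | rfl | rfl)
      exacts [h0 0, h0 1, h0 2]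
    exact hle hp
  · have hm : (d + 1) / 2 = d % 2 + e := by omega
    rw [hm]
    exact exists_minimal_syzygies (by omega) (by omega) (by omega) hf
      (isRelPrime_of_dvd_X_pow hX) hf0 fun a ha h =>
        eq_zero_of_totalDegree_le hf hB (fun i => Nat.le_sub_one_of_lt (ha i)) h
end
end

section
/- Let k be an infinite field of characteristic ≠ 2, let d = 2s+1 with s ≥ 2, and let S = k[T_l^{(t)} : 1 ≤ t ≤ 3, 0 ≤ l ≤ 2s+1] be a polynomial ring in 3(d+1) variables. For each pair 1 ≤ t₁ ≤ t₂ ≤ 3 and each 0 ≤ r ≤ 4s+2, define the quadratic form Q_r^{t₁,t₂} = Σ T_{l}^{(t₁)} T_{r−l}^{(t₂)}, the sum over all l with 0 ≤ l ≤ 2s+1 and 0 ≤ r−l ≤ 2s+1. Let B_{t₁,t₂} be the (5s+2) × s matrix with (i,j) entry Q_{i−j}^{t₁,t₂} if 0 ≤ i−j ≤ 4s+2 and 0 otherwise (indices starting at (1,1), so each Q_r is displayed s times along a diagonal). Then the (5s+2) × 6s concatenation A = [B_{1,1} B_{1,2} B_{1,3} B_{2,2} B_{2,3} B_{3,3}]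 has maximal rank 5s+2 over the fraction field of S. -/
open MvPolynomial

noncomputable section

/-- The quadratic form `Q_r^{t₁,t₂} = Σ T_l^{(t₁)} T_{r−l}^{(t₂)}`, the sum over all `l`
with `0 ≤ l ≤ d` and `0 ≤ r − l ≤ d`, in the polynomial ring
`S = k[T_l^{(t)} : 1 ≤ t ≤ 3, 0 ≤ l ≤ d]` (variables indexed by `Fin 3 × Fin (d+1)`). -/
def Qform (k : Type*) [Field k] (d r : ℕ) (t₁ t₂ : Fin 3) :
    MvPolynomial (Fin 3 × Fin (d + 1)) k :=
  ∑ l : Fin (d + 1),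
    if h : (l : ℕ) ≤ r ∧ r - (l : ℕ) ≤ d then
      X (t₁, l) * X (t₂, ⟨r - (l : ℕ), Nat.lt_succ_of_le h.2⟩)
    else 0

/-- The six pairs `(t₁,t₂)` with `1 ≤ t₁ ≤ t₂ ≤ 3` (0-indexed), ordering the blocks
`B_{1,1}, B_{1,2}, B_{1,3}, B_{2,2}, B_{2,3}, B_{3,3}`. -/
def blockPairs : Fin 6 → Fin 3 × Fin 3 :=
  ![(0, 0), (0, 1), (0, 2), (1, 1), (1, 2), (2, 2)]

/-- The specialization of the three generic polynomials `Σ T_l^{(t)} x^l` used to witness maximal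
rank. -/
def specialPoly (k : Type*) [Field k] (s : ℕ) : Fin 3 → Polynomial k :=
  ![1, Polynomial.X ^ s - Polynomial.X ^ (s + 1), Polynomial.X ^ (2 * s + 1)]

lemma natDegree_specialPoly_le (k : Type*) [Field k] (s : ℕ) (t : Fin 3) :
    (specialPoly k s t).natDegree ≤ 2 * s + 1 := by
  fin_cases t
  · simp [specialPoly]
  · refine (Polynomial.natDegree_sub_le _ _).trans ?_
    simp only [Polynomial.natDegree_X_pow]
    omega
  · simp [specialPoly]

lemma eval_Qform {k : Type*} [Field k] {d : ℕ} (F : Fin 3 → Polynomial k)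
    (hF : ∀ t, (F t).natDegree ≤ d) (r : ℕ) (t₁ t₂ : Fin 3) :
    eval (fun p => (F p.1).coeff p.2) (Qform k d r t₁ t₂) = (F t₁ * F t₂).coeff r := by
  have hterm : ∀ l : Fin (d + 1),
      eval (fun p : Fin 3 × Fin (d + 1) => (F p.1).coeff p.2)
        (if h : (l : ℕ) ≤ r ∧ r - (l : ℕ) ≤ d then
          X (t₁, l) * X (t₂, ⟨r - (l : ℕ), Nat.lt_succ_of_le h.2⟩) else 0) =
      if (l : ℕ) ≤ r then (F t₁).coeff l * (F t₂).coeff (r - l) else 0 := by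
    intro l
    by_cases h₁ : (l : ℕ) ≤ r
    · by_cases h₂ : r - (l : ℕ) ≤ d
      · simp [h₁, h₂]
      · have h₃ : (F t₂).coeff (r - l) = 0 :=
          Polynomial.coeff_eq_zero_of_natDegree_lt ((hF t₂).trans_lt (by omega))
        simp [h₂, h₃]
    · simp [h₁]
  rw [Qform, map_sum, Finset.sum_congr rfl fun l _ => hterm l,
    Fin.sum_univ_eq_sum_range
      (fun l => if l ≤ r then (F t₁).coeff l * (F t₂).coeff (r - l) else 0),
    Polynomial.coeff_mul, Finset.Nat.sum_antidiagonal_eq_sum_range_succ_mk, ← Finset.sum_filter]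
  refine Finset.sum_subset (fun l hl => ?_) fun l hl hl' => ?_
  · simp only [Finset.mem_filter, Finset.mem_range] at hl ⊢
    omega
  · simp only [Finset.mem_filter, Finset.mem_range] at hl hl'
    rw [Polynomial.coeff_eq_zero_of_natDegree_lt ((hF t₁).trans_lt (by omega)), zero_mul]

/-- The linear functional on polynomials which pairs the first `n` coefficients with `φ`. -/
def coeffPairing {k : Type*} [Field k] {n : ℕ} (φ : Fin n → k) : Polynomial k →ₗ[k] k :=
  ∑ i : Fin n, φ i • Polynomial.lcoeff k i

lemma coeffPairing_apply {k : Type*} [Field k] {n : ℕ} (φ : Fin n → k) (P : Polynomial k) :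
    coeffPairing φ P = ∑ i : Fin n, φ i * P.coeff i := by
  simp [coeffPairing]

lemma coeffPairing_X_pow {k : Type*} [Field k] {n : ℕ} (φ : Fin n → k) (i : Fin n) :
    coeffPairing φ (Polynomial.X ^ (i : ℕ)) = φ i := by
  simp [coeffPairing_apply, Polynomial.coeff_X_pow, Fin.val_inj]

lemma eq_zero_of_pairing_specialPoly {k : Type*} [Field k] {s : ℕ} (hs : 2 ≤ s)
    (L : Polynomial k →ₗ[k] k)
    (hL : ∀ b : Fin 6, ∀ j < s, L (Polynomial.X ^ j *
      (specialPoly k s (blockPairs b).1 * specialPoly k s (blockPairs b).2)) = 0)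
    (m : ℕ) (hm : m < 5 * s + 2) : L (Polynomial.X ^ m) = 0 := by
  have h₀ : ∀ j < s, L (Polynomial.X ^ j) = 0 := fun j hj => by
    simpa [specialPoly, blockPairs] using hL 0 j hj
  have h₁ : ∀ j < s, L (Polynomial.X ^ (s + j)) = L (Polynomial.X ^ (s + j + 1)) := fun j hj => by
    rw [← sub_eq_zero, ← map_sub, ← hL 1 j hj]
    congr 1
    simp [specialPoly, blockPairs]
    ring
  have h₂ : ∀ j < s, L (Polynomial.X ^ (2 * s + 1 + j)) = 0 := fun j hj => by
    rw [← hL 2 j hj]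
    congr 1
    simp [specialPoly, blockPairs]
    ring
  have h₃ : ∀ j < s, L (Polynomial.X ^ (2 * s + j)) - (2 : k) • L (Polynomial.X ^ (2 * s + 1 + j))
      + L (Polynomial.X ^ (2 * s + 2 + j)) = 0 := fun j hj => by
    rw [← map_smul, ← map_sub, ← map_add, ← hL 3 j hj]
    congr 1
    simp [specialPoly, blockPairs, two_smul]
    ring
  have h₄ : ∀ j < s, L (Polynomial.X ^ (3 * s + 1 + j)) = L (Polynomial.X ^ (3 * s + 1 + j + 1)) :=
    fun j hj => by
      rw [← sub_eq_zero, ← map_sub, ← hL 4 j hj]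
      congr 1
      simp [specialPoly, blockPairs]
      ring
  have h₅ : ∀ j < s, L (Polynomial.X ^ (4 * s + 2 + j)) = 0 := fun j hj => by
    rw [← hL 5 j hj]
    congr 1
    simp [specialPoly, blockPairs]
    ring
  have hlow : ∀ j ≤ s, L (Polynomial.X ^ (s + j)) = L (Polynomial.X ^ s) := by
    intro j
    induction j with
    | zero => simp
    | succ j ih => exact fun hj => (h₁ j (by omega)).symm.trans (ih (by omega))
  have hhigh : ∀ j ≤ s, L (Polynomial.X ^ (3 * s + 1 + j)) = L (Polynomial.X ^ (3 * s + 1)) := by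
    intro j
    induction j with
    | zero => simp
    | succ j ih => exact fun hj => (h₄ j (by omega)).symm.trans (ih (by omega))
  have hs₁ : L (Polynomial.X ^ s) = 0 := by
    have h := h₃ 0 (by omega)
    rw [h₂ 0 (by omega), show 2 * s + 2 + 0 = 2 * s + 1 + 1 by ring, h₂ 1 (by omega),
      show 2 * s + 0 = s + s by ring, hlow s le_rfl] at h
    simpa using h
  have hs₂ : L (Polynomial.X ^ (3 * s + 1)) = 0 := by
    have h := h₃ (s - 1) (by omega)
    rw [h₂ (s - 1) (by omega), show 2 * s + (s - 1) = 2 * s + 1 + (s - 2) by omega,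
      h₂ (s - 2) (by omega), show 2 * s + 2 + (s - 1) = 3 * s + 1 by omega] at h
    simpa using h
  rcases lt_or_ge m s with h | h
  · exact h₀ m h
  rcases le_or_gt m (2 * s) with h' | h'
  · obtain ⟨j, rfl⟩ := Nat.exists_eq_add_of_le h
    rw [hlow j (by omega), hs₁]
  rcases le_or_gt m (3 * s) with h'' | h''
  · obtain ⟨j, rfl⟩ := Nat.exists_eq_add_of_le (show 2 * s + 1 ≤ m from h')
    exact h₂ j (by omega)
  rcases le_or_gt m (4 * s + 1) with h''' | h'''
  · obtain ⟨j, rfl⟩ := Nat.exists_eq_add_of_le (show 3 * s + 1 ≤ m from h'')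
    rw [hhigh j (by omega), hs₂]
  · obtain ⟨j, rfl⟩ := Nat.exists_eq_add_of_le (show 4 * s + 2 ≤ m from h''')
    exact h₅ j (by omega)

/-- A matrix over a polynomial ring has full row rank over the fraction field as soon as one of
its specializations has linearly independent rows. -/
lemma rank_map_algebraMap_of_eval {k σ n : Type*} [Field k] [Fintype n] {m : ℕ}
    (A : Matrix (Fin m) n (MvPolynomial σ k)) (v : σ → k)
    (hA : Function.Injective (A.map (eval v)).vecMul) :
    (A.map (algebraMap (MvPolynomial σ k) (FractionRing (MvPolynomial σ k)))).rank = m := by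
  classical
  have hrank : (A.map (eval v)).rank = m := by
    simpa using (Matrix.vecMul_injective_iff.mp hA).rank_matrix
  have hsurj : Function.Surjective (A.map (eval v)).mulVec := by
    have h : LinearMap.range (A.map (eval v)).mulVecLin = ⊤ :=
      Submodule.eq_top_of_finrank_eq (by simpa [Matrix.rank] using hrank)
    exact LinearMap.range_eq_top.mp h
  obtain ⟨R, hR⟩ := Matrix.mulVec_surjective_iff_exists_right_inverse.mp hsurj
  let B : Matrix n (Fin m) (MvPolynomial σ k) := R.map C
  have hdet : (A * B).det ≠ 0 := by
    intro h
    have h' : eval v (A * B).det = 1 := by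
      have hB : B.map (eval v) = R := by ext; simp [B]
      rw [RingHom.map_det, RingHom.mapMatrix_apply, Matrix.map_mul, hB, hR, Matrix.det_one]
    simp [h] at h'
  let ι := algebraMap (MvPolynomial σ k) (FractionRing (MvPolynomial σ k))
  have hunit : IsUnit (A.map ι * B.map ι) := by
    rw [← Matrix.map_mul, Matrix.isUnit_iff_isUnit_det, isUnit_iff_ne_zero,
      ← RingHom.mapMatrix_apply, ← RingHom.map_det]
    exact (map_ne_zero_iff ι (IsFractionRing.injective _ _)).mpr hdet
  refine le_antisymm (by simpa using (A.map ι).rank_le_card_height) ?_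
  have hle := Matrix.rank_mul_le_left (A.map ι) (B.map ι)
  rwa [Matrix.rank_of_isUnit _ hunit, Fintype.card_fin] at hle

/-- Let `k` be an infinite field of characteristic ≠ 2 and `d = 2s+1` with `s ≥ 2`.
The `(5s+2) × 6s` concatenation `A = [B_{1,1} B_{1,2} B_{1,3} B_{2,2} B_{2,3} B_{3,3}]`,
where `B_{t₁,t₂}` is the `(5s+2) × s` matrix whose `(i,j)` entry is `Q_{i−j}^{t₁,t₂}`
when `0 ≤ i−j ≤ 4s+2` (and `0` otherwise; note `Q_r = 0` for `r > 4s+2` anyway), has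
maximal rank `5s+2` over the fraction field of `S`. -/
theorem matrix_lemma_odd (k : Type*) [Field k] [Infinite k] (h2 : (2 : k) ≠ 0)
    (s : ℕ) (hs : 2 ≤ s) :
    Matrix.rank
      (Matrix.map
        (Matrix.of fun (i : Fin (5 * s + 2)) (bj : Fin 6 × Fin s) =>
          if (bj.2 : ℕ) ≤ (i : ℕ) then
            Qform k (2 * s + 1) ((i : ℕ) - (bj.2 : ℕ)) (blockPairs bj.1).1 (blockPairs bj.1).2
          else 0)
        (algebraMap (MvPolynomial (Fin 3 × Fin (2 * s + 1 + 1)) k)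
          (FractionRing (MvPolynomial (Fin 3 × Fin (2 * s + 1 + 1)) k))))
      = 5 * s + 2 := by
  refine rank_map_algebraMap_of_eval _ (fun p => (specialPoly k s p.1).coeff p.2) ?_
  refine (injective_iff_map_eq_zero (Matrix.vecMulLinear _)).mpr fun φ hφ => ?_
  funext i
  rw [← coeffPairing_X_pow φ i]
  refine eq_zero_of_pairing_specialPoly hs _ (fun b j hj => ?_) i i.2
  refine Eq.trans ?_ (congrFun hφ (b, ⟨j, hj⟩))
  rw [coeffPairing_apply]
  simp only [Matrix.vecMulLinear_apply, Matrix.vecMul, dotProduct, Matrix.map_apply,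
    Matrix.of_apply]
  refine Finset.sum_congr rfl fun l _ => ?_
  rw [Polynomial.coeff_X_pow_mul', apply_ite (eval _), map_zero,
    eval_Qform _ (natDegree_specialPoly_le k s)]
end
end

section
/- Let k be an infinite field of characteristic ≠ 2, let d = 2s with s ≥ 5, and let S = k[T_l^{(t)} : 1 ≤ t ≤ 3, 0 ≤ l ≤ 2s] be a polynomial ring in 3(d+1) variables. For each pair 1 ≤ t₁ ≤ t₂ ≤ 3 and each 0 ≤ r ≤ 4s, define the quadratic form Q_r^{t₁,t₂} = Σ T_{l}^{(t₁)} T_{r−l}^{(t₂)}, the sum over all l with 0 ≤ l ≤ 2s and 0 ≤ r−l ≤ 2s. Let B_{t₁,t₂} be the (5s−1) × (s−1) matrix with (i,j) entry Q_{i−j}^{t₁,t₂} if 0 ≤ i−j ≤ 4s and 0 otherwise (indices starting at (1,1), so each Q_r is displayed s−1 times along a diagonal). Then the (5s−1) × 6(s−1) concatenation A = [B_{1,1} B_{1,2} B_{1,3} B_{2,2} B_{2,3} B_{3,3}] has maximal rank 5s−1 over the fraction field of S. -/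
open MvPolynomial

noncomputable section

/-- A polynomial matrix whose specialization at a point has independent rows has full row rank. -/
lemma rank_map_fractionRing_eq_card {k σ m n : Type*} [Field k] [Fintype m] [Fintype n]
    (M : Matrix m n (MvPolynomial σ k)) (φ : MvPolynomial σ k →ₐ[k] k)
    (h : ∀ y : m → k, Matrix.vecMul y (M.map φ) = 0 → y = 0) :
    (M.map (algebraMap (MvPolynomial σ k) (FractionRing (MvPolynomial σ k)))).rank =
      Fintype.card m := by
  classical
  have hinj : Function.Injective (M.map φ).vecMul := by
    intro x y hxy
    rw [← sub_eq_zero]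
    apply h
    rw [Matrix.sub_vecMul, sub_eq_zero]
    exact hxy
  have hrank := (Matrix.vecMul_injective_iff.1 hinj).rank_matrix
  have hsurj : Function.Surjective (M.map φ).mulVec := by
    rw [← Matrix.coe_mulVecLin, ← LinearMap.range_eq_top]
    apply Submodule.eq_top_of_finrank_eq
    rw [Module.finrank_fintype_fun_eq_card]
    exact hrank
  obtain ⟨N, hN⟩ := Matrix.mulVec_surjective_iff_exists_right_inverse.1 hsurj
  have hdet : (M * N.map (MvPolynomial.C : k →+* MvPolynomial σ k)).det ≠ 0 := by
    intro h0
    have h1 := congrArg φ h0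
    rw [AlgHom.map_det, AlgHom.mapMatrix_apply, Matrix.map_mul, Matrix.map_map, map_zero] at h1
    have h2 : N.map (φ ∘ (MvPolynomial.C : k →+* MvPolynomial σ k)) = N := by
      ext i j
      exact φ.commutes (N i j)
    rw [h2, hN, Matrix.det_one] at h1
    exact one_ne_zero h1
  apply le_antisymm (Matrix.rank_le_card_height _)
  set ι := algebraMap (MvPolynomial σ k) (FractionRing (MvPolynomial σ k))
  have hdet' : ((M * N.map (MvPolynomial.C : k →+* MvPolynomial σ k)).map ι).det ≠ 0 := by
    rw [← RingHom.mapMatrix_apply, ← RingHom.map_det]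
    exact (map_ne_zero_iff ι (IsFractionRing.injective _ _)).2 hdet
  rw [← Matrix.rank_of_det_ne_zero hdet', Matrix.map_mul]
  exact Matrix.rank_mul_le_left _ _

lemma aeval_Qform {k : Type*} [Field k] {d : ℕ} (f : Fin 3 → Polynomial k)
    (hf : ∀ t, (f t).natDegree ≤ d) (r : ℕ) (t₁ t₂ : Fin 3) :
    aeval (fun p : Fin 3 × Fin (d + 1) => (f p.1).coeff p.2) (Qform k d r t₁ t₂) =
      (f t₁ * f t₂).coeff r := by
  have hzero : ∀ t n, d < n → (f t).coeff n = 0 := fun t n hn =>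
    Polynomial.coeff_eq_zero_of_natDegree_lt ((hf t).trans_lt hn)
  have hterm : ∀ l : Fin (d + 1),
      aeval (fun p : Fin 3 × Fin (d + 1) => (f p.1).coeff p.2)
        (if h : (l : ℕ) ≤ r ∧ r - (l : ℕ) ≤ d then
          (X (t₁, l) * X (t₂, ⟨r - (l : ℕ), Nat.lt_succ_of_le h.2⟩) :
            MvPolynomial (Fin 3 × Fin (d + 1)) k)
        else 0) =
      if (l : ℕ) ≤ r then (f t₁).coeff l * (f t₂).coeff (r - l) else 0 := by
    intro l
    by_cases h₁ : (l : ℕ) ≤ r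
    · by_cases h₂ : r - (l : ℕ) ≤ d
      · simp [h₁, h₂]
      · rw [dif_neg (fun h => h₂ h.2), if_pos h₁, hzero t₂ _ (not_le.1 h₂), mul_zero, map_zero]
    · rw [dif_neg (fun h => h₁ h.1), if_neg h₁, map_zero]
  rw [Qform, map_sum, Finset.sum_congr rfl fun l _ => hterm l, Polynomial.coeff_mul,
    Finset.Nat.sum_antidiagonal_eq_sum_range_succ_mk,
    Fin.sum_univ_eq_sum_range
      (fun l => if l ≤ r then (f t₁).coeff l * (f t₂).coeff (r - l) else 0) (d + 1),
    ← Finset.sum_filter]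
  apply Finset.sum_subset
  · intro l hl
    simp only [Finset.mem_filter, Finset.mem_range] at hl ⊢
    omega
  · intro l hl hl'
    simp only [Finset.mem_filter, Finset.mem_range] at hl hl'
    rw [hzero t₁ l (by omega), zero_mul]

/-- The specialization `1, x^{2s}, x + x^s + x^{2s-1}` of the three generic forms. -/
def specialForms (k : Type*) [Field k] (s : ℕ) : Fin 3 → Polynomial k :=
  ![1, Polynomial.X ^ (2 * s),
    Polynomial.X ^ 1 + Polynomial.X ^ s + Polynomial.X ^ (2 * s - 1)]

lemma natDegree_specialForms_le (k : Type*) [Field k] {s : ℕ} (hs : 1 ≤ s) (t : Fin 3) :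
    (specialForms k s t).natDegree ≤ 2 * s := by
  fin_cases t
  · simp [specialForms]
  · simp [specialForms]
  · refine Polynomial.natDegree_add_le_of_degree_le
      (Polynomial.natDegree_add_le_of_degree_le ?_ ?_) ?_ <;>
    exact (Polynomial.natDegree_X_pow_le _).trans (by omega)

lemma eq_zero_of_specialForms_relations {k : Type*} [Field k] {s : ℕ} (hs : 5 ≤ s) (Y : ℕ → k)
    (h₁₁ : ∀ j < s - 1, Y j = 0)
    (h₁₂ : ∀ j < s - 1, Y (2 * s + j) = 0)
    (h₁₃ : ∀ j < s - 1, Y (1 + j) + Y (s + j) + Y (2 * s - 1 + j) = 0)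
    (h₂₂ : ∀ j < s - 1, Y (4 * s + j) = 0)
    (h₂₃ : ∀ j < s - 1, Y (2 * s + 1 + j) + Y (3 * s + j) + Y (4 * s - 1 + j) = 0)
    (h₃₃ : ∀ j < s - 1, Y (2 + j) + Y (2 * s + j) + Y (4 * s - 2 + j) +
      2 * (Y (s + 1 + j) + Y (2 * s + j) + Y (3 * s - 1 + j)) = 0)
    {n : ℕ} (hn : n < 5 * s - 1) : Y n = 0 := by
  have low : ∀ n, n < s - 1 → Y n = 0 := h₁₁
  have mid : ∀ n, 2 * s ≤ n → n < 3 * s - 1 → Y n = 0 := fun n h h' => by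
    simpa [show 2 * s + (n - 2 * s) = n by omega] using h₁₂ (n - 2 * s) (by omega)
  have high : ∀ n, 4 * s ≤ n → n < 5 * s - 1 → Y n = 0 := fun n h h' => by
    simpa [show 4 * s + (n - 4 * s) = n by omega] using h₂₂ (n - 4 * s) (by omega)
  have gap₁ : ∀ n, s < n → n < 2 * s - 2 → Y n = 0 := fun n h h' => by
    have e := h₁₃ (n - s) (by omega)
    rwa [low (1 + _) (by omega), mid (2 * s - 1 + _) (by omega) (by omega),
      show s + (n - s) = n by omega, zero_add, add_zero] at e
  have gap₂ : ∀ n, 3 * s < n → n < 4 * s - 2 → Y n = 0 := fun n h h' => by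
    have e := h₂₃ (n - 3 * s) (by omega)
    rwa [mid (2 * s + 1 + _) (by omega) (by omega), high (4 * s - 1 + _) (by omega) (by omega),
      show 3 * s + (n - 3 * s) = n by omega, zero_add, add_zero] at e
  have a₁ : Y s + Y (2 * s - 1) = 0 := by
    have e := h₁₃ 0 (by omega)
    rwa [low _ (by omega), zero_add] at e
  have a₂ : Y (s - 1) + Y (2 * s - 2) = 0 := by
    have e := h₁₃ (s - 2) (by omega)
    rwa [mid (2 * s - 1 + (s - 2)) (by omega) (by omega), add_zero,
      show 1 + (s - 2) = s - 1 by omega, show s + (s - 2) = 2 * s - 2 by omega] at e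
  have b₁ : Y (3 * s) + Y (4 * s - 1) = 0 := by
    have e := h₂₃ 0 (by omega)
    rwa [mid _ (by omega) (by omega), zero_add] at e
  have b₂ : Y (3 * s - 1) + Y (4 * s - 2) = 0 := by
    have e := h₂₃ (s - 2) (by omega)
    rwa [high (4 * s - 1 + (s - 2)) (by omega) (by omega), add_zero,
      show 2 * s + 1 + (s - 2) = 3 * s - 1 by omega,
      show 3 * s + (s - 2) = 4 * s - 2 by omega] at e
  have z₁ : Y (s - 1) = 0 := by
    have e := h₃₃ (s - 3) (by omega)
    rw [mid (2 * s + _) (by omega) (by omega), high (4 * s - 2 + _) (by omega) (by omega),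
      gap₂ (3 * s - 1 + _) (by omega) (by omega), show 2 + (s - 3) = s - 1 by omega,
      show s + 1 + (s - 3) = 2 * s - 2 by omega] at e
    linear_combination 2 * a₂ - e
  have z₂ : Y (2 * s - 1) = 0 := by
    have e := h₃₃ (s - 2) (by omega)
    rw [mid (2 * s + _) (by omega) (by omega), high (4 * s - 2 + _) (by omega) (by omega),
      gap₂ (3 * s - 1 + _) (by omega) (by omega), show 2 + (s - 2) = s by omega,
      show s + 1 + (s - 2) = 2 * s - 1 by omega] at e
    linear_combination e - a₁
  have z₃ : Y (3 * s - 1) = 0 := by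
    have e := h₃₃ 0 (by omega)
    rw [low (2 + _) (by omega), mid (2 * s + _) (by omega) (by omega),
      gap₁ (s + 1 + _) (by omega) (by omega), add_zero (4 * s - 2), add_zero (3 * s - 1)] at e
    linear_combination e - b₂
  have z₄ : Y (4 * s - 1) = 0 := by
    have e := h₃₃ 1 (by omega)
    rw [low (2 + _) (by omega), mid (2 * s + _) (by omega) (by omega),
      gap₁ (s + 1 + _) (by omega) (by omega), show 4 * s - 2 + 1 = 4 * s - 1 by omega,
      show 3 * s - 1 + 1 = 3 * s by omega] at e
    linear_combination 2 * b₁ - e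
  rw [z₂, add_zero] at a₁
  rw [z₁, zero_add] at a₂
  rw [z₄, add_zero] at b₁
  rw [z₃, zero_add] at b₂
  have cases : n < s - 1 ∨ n = s - 1 ∨ n = s ∨ (s < n ∧ n < 2 * s - 2) ∨ n = 2 * s - 2 ∨
      n = 2 * s - 1 ∨ (2 * s ≤ n ∧ n < 3 * s - 1) ∨ n = 3 * s - 1 ∨ n = 3 * s ∨
      (3 * s < n ∧ n < 4 * s - 2) ∨ n = 4 * s - 2 ∨ n = 4 * s - 1 ∨
      (4 * s ≤ n ∧ n < 5 * s - 1) := by omega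
  rcases cases with h | rfl | rfl | ⟨h, h'⟩ | rfl | rfl | ⟨h, h'⟩ | rfl | rfl | ⟨h, h'⟩ | rfl |
    rfl | ⟨h, h'⟩
  exacts [low _ h, z₁, a₁, gap₁ _ h h', a₂, z₂, mid _ h h', z₃, b₁, gap₂ _ h h', b₂, z₄,
    high _ h h']

/-- Let `k` be an infinite field of characteristic ≠ 2 and `d = 2s` with `s ≥ 5`.
The `(5s−1) × 6(s−1)` concatenation `A = [B_{1,1} B_{1,2} B_{1,3} B_{2,2} B_{2,3} B_{3,3}]`,
where `B_{t₁,t₂}` is the `(5s−1) × (s−1)` matrix whose `(i,j)` entry is `Q_{i−j}^{t₁,t₂}`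
when `0 ≤ i−j ≤ 4s` (and `0` otherwise; note `Q_r = 0` for `r > 4s` anyway), has
maximal rank `5s−1` over the fraction field of `S`. -/
theorem matrix_lemma_even (k : Type*) [Field k] [Infinite k] (h2 : (2 : k) ≠ 0)
    (s : ℕ) (hs : 5 ≤ s) :
    Matrix.rank
      (Matrix.map
        (Matrix.of fun (i : Fin (5 * s - 1)) (bj : Fin 6 × Fin (s - 1)) =>
          if (bj.2 : ℕ) ≤ (i : ℕ) then
            Qform k (2 * s) ((i : ℕ) - (bj.2 : ℕ)) (blockPairs bj.1).1 (blockPairs bj.1).2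
          else 0)
        (algebraMap (MvPolynomial (Fin 3 × Fin (2 * s + 1)) k)
          (FractionRing (MvPolynomial (Fin 3 × Fin (2 * s + 1)) k))))
      = 5 * s - 1 := by
  rw [rank_map_fractionRing_eq_card _ (aeval fun p : Fin 3 × Fin (2 * s + 1) =>
    (specialForms k s p.1).coeff p.2), Fintype.card_fin]
  intro y hy
  let L : Polynomial k →ₗ[k] k :=
    ∑ i : Fin (5 * s - 1), y i • Polynomial.lcoeff k i
  have hL : ∀ p, L p = ∑ i : Fin (5 * s - 1), y i * p.coeff i := fun p => by
    simp [L, LinearMap.sum_apply]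
  have hLX : ∀ i : Fin (5 * s - 1), L (Polynomial.X ^ (i : ℕ)) = y i := fun i => by
    simp [hL, Polynomial.coeff_X_pow, Fin.val_inj]
  have key : ∀ (b : Fin 6), ∀ j < s - 1, L (specialForms k s (blockPairs b).1 *
      specialForms k s (blockPairs b).2 * Polynomial.X ^ j) = 0 := by
    intro b j hj
    rw [hL]
    refine Eq.trans ?_ (congrFun hy (b, ⟨j, hj⟩))
    refine Finset.sum_congr rfl fun i _ => ?_
    beta_reduce
    rw [Matrix.map_apply, Matrix.of_apply, apply_ite (aeval _), map_zero,
      aeval_Qform _ (natDegree_specialForms_le k (by omega)), Polynomial.coeff_mul_X_pow']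
  ext i
  rw [← hLX i]
  refine eq_zero_of_specialForms_relations hs (fun n => L (Polynomial.X ^ n))
    ?_ ?_ ?_ ?_ ?_ ?_ i.2
  · intro j hj
    simpa [specialForms, blockPairs] using key 0 j hj
  · intro j hj
    simpa [specialForms, blockPairs, pow_add] using key 1 j hj
  · intro j hj
    simpa [specialForms, blockPairs, pow_add, add_mul] using key 2 j hj
  · intro j hj
    simpa [specialForms, blockPairs, ← pow_add, ← two_mul, ← mul_assoc] using key 3 j hj
  · intro j hj
    rw [show 3 * s = 2 * s + s by omega, show 4 * s - 1 = 2 * s + (2 * s - 1) by omega]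
    simpa [specialForms, blockPairs, pow_add, add_mul, mul_add] using key 4 j hj
  · intro j hj
    rw [← key 5 j hj]
    have e : (specialForms k s (blockPairs 5).1 * specialForms k s (blockPairs 5).2 *
        Polynomial.X ^ j : Polynomial k) =
        Polynomial.X ^ (2 + j) + Polynomial.X ^ (2 * s + j) + Polynomial.X ^ (4 * s - 2 + j) +
        (2 : k) • (Polynomial.X ^ (s + 1 + j) + Polynomial.X ^ (2 * s + j) +
          Polynomial.X ^ (3 * s - 1 + j)) := by
      obtain ⟨m, rfl⟩ : ∃ m, s = m + 1 := ⟨s - 1, by omega⟩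
      rw [show 4 * (m + 1) - 2 = 4 * m + 2 by omega, show 3 * (m + 1) - 1 = 3 * m + 2 by omega,
        Polynomial.smul_eq_C_mul]
      simp only [specialForms, blockPairs, show 2 * (m + 1) - 1 = 2 * m + 1 by omega,
        Matrix.cons_val, map_ofNat]
      ring
    rw [e]
    simp only [map_add, map_smul, smul_eq_mul]
end
end

section
/- Let k be an infinite field of characteristic ≠ 2 and let d be an integer with d ≥ 5 if d is odd, respectively d ≥ 10 if d is even. For general forms f₁, f₂, f₃ of degree d in R = k[x,y], setting I = (f₁, f₂, f₃) (which has codimension 2), the colon ideal I² : I is not contained in I; in particular I² : I ≠ I. -/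
open MvPolynomial

noncomputable section

/-- Let `d = 2 * m + 1`. A sequence satisfying the relations which the products of `x ^ d`, `y ^ d`
and `x ^ m * y ^ (d - m) + x ^ (2 * m) * y ^ (d - 2 * m)` impose on the monomials of degree
`2 * d + (m - 1)` vanishes. -/
lemma eq_zero_of_relations_odd {V : Type*} [AddCommGroup V] (T : ℕ → V) (m : ℕ) (hm : 2 ≤ m)
    (h₀ : ∀ i < m, T i = 0) (h₁ : ∀ i < m, T (2 * m + 1 + i) = 0)
    (h₂ : ∀ i < m, T (2 * (2 * m + 1) + i) = 0)
    (h₃ : ∀ i < m, T (m + i) + T (2 * m + i) = 0)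
    (h₄ : ∀ i < m, T (2 * m + 1 + m + i) + T (2 * m + 1 + 2 * m + i) = 0)
    (h₅ : ∀ i < m, T (2 * m + i) + 2 • T (m + 2 * m + i) + T (2 * (2 * m) + i) = 0) :
    ∀ e ≤ 5 * m + 1, T e = 0 := by
  have low : ∀ i < m, 1 ≤ i → T (m + i) = 0 := by
    intro i hi h1
    have := h₁ (i - 1) (by lia)
    rw [show 2 * m + 1 + (i - 1) = 2 * m + i by lia] at this
    simpa [this] using h₃ i hi
  have high : ∀ i < m, 1 ≤ i → T (3 * m + 1 + i) = 0 := by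
    intro i hi h1
    have := h₂ (i - 1) (by lia)
    rw [show 2 * (2 * m + 1) + (i - 1) = 2 * m + 1 + 2 * m + i by lia] at this
    have h := h₄ i hi
    rw [this, add_zero] at h
    rw [← h]; congr 1; lia
  have a1 : T (2 * m) = 0 := by
    have h := h₅ 0 (by lia)
    have e1 := h₁ (m - 1) (by lia)
    have e2 := high (m - 1) (by lia) (by lia)
    rw [show 2 * m + 1 + (m - 1) = m + 2 * m by lia] at e1
    rw [show 3 * m + 1 + (m - 1) = 2 * (2 * m) by lia] at e2
    simpa [e1, e2] using h
  have a2 : T m = 0 := by simpa [a1] using h₃ 0 (by lia)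
  have a3 : T (4 * m + 1) + T (3 * m + 1) = 0 := by
    have h := h₄ 0 (by lia)
    rw [add_comm, ← h]; congr 2 <;> lia
  have a4 : T (3 * m + 1) = 0 := by
    have h := h₅ 1 (by lia)
    have e1 := h₁ 0 (by lia)
    rw [add_zero] at e1
    rw [e1, show m + 2 * m + 1 = 3 * m + 1 by lia, show 2 * (2 * m) + 1 = 4 * m + 1 by lia,
      eq_neg_of_add_eq_zero_left a3, two_smul] at h
    simpa using h
  have a5 : T (4 * m + 1) = 0 := by simpa [a4] using a3
  intro e he
  by_cases c1 : e < m
  · exact h₀ e c1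
  by_cases c2 : e = m
  · rw [c2, a2]
  by_cases c3 : e < 2 * m
  · have := low (e - m) (by lia) (by lia); rwa [show m + (e - m) = e by lia] at this
  by_cases c4 : e = 2 * m
  · rw [c4, a1]
  by_cases c5 : e < 3 * m + 1
  · have := h₁ (e - (2 * m + 1)) (by lia)
    rwa [show 2 * m + 1 + (e - (2 * m + 1)) = e by lia] at this
  by_cases c6 : e = 3 * m + 1
  · rw [c6, a4]
  by_cases c7 : e < 4 * m + 1
  · have := high (e - (3 * m + 1)) (by lia) (by lia)
    rwa [show 3 * m + 1 + (e - (3 * m + 1)) = e by lia] at this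
  by_cases c8 : e = 4 * m + 1
  · rw [c8, a5]
  · have := h₂ (e - (2 * (2 * m + 1))) (by lia)
    rwa [show 2 * (2 * m + 1) + (e - (2 * (2 * m + 1))) = e by lia] at this

/-- Let `d = 2 * (n + 2)`. A sequence satisfying the relations which the products of `x ^ d`, `y ^ d`
and `x ^ (n + 1) * y ^ (n + 3) + x ^ (n + 3) * y ^ (n + 1)` impose on the monomials of degree
`2 * d + n` vanishes. -/
lemma eq_zero_of_relations_even {V : Type*} [AddCommGroup V] (T : ℕ → V) (n : ℕ) (hn : 3 ≤ n)
    (h₀ : ∀ i ≤ n, T i = 0) (h₁ : ∀ i ≤ n, T (2 * (n + 2) + i) = 0)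
    (h₂ : ∀ i ≤ n, T (2 * (2 * (n + 2)) + i) = 0)
    (h₃ : ∀ i ≤ n, T (n + 1 + i) + T (n + 3 + i) = 0)
    (h₄ : ∀ i ≤ n, T (2 * (n + 2) + (n + 1) + i) + T (2 * (n + 2) + (n + 3) + i) = 0)
    (h₅ : ∀ i ≤ n, T (2 * (n + 1) + i) + 2 • T (n + 1 + (n + 3) + i) + T (2 * (n + 3) + i) = 0) :
    ∀ e ≤ 2 * (2 * (n + 2)) + n, T e = 0 := by
  have mid : ∀ e, 2 * n + 4 ≤ e → e ≤ 3 * n + 4 → T e = 0 := by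
    intro e h1 h2
    have := h₁ (e - 2 * (n + 2)) (by lia)
    rwa [show 2 * (n + 2) + (e - 2 * (n + 2)) = e by lia] at this
  have sq : ∀ i ≤ n, T (2 * n + 2 + i) + 2 • T (2 * n + 4 + i) + T (2 * n + 6 + i) = 0 := by
    intro i hi
    have h := h₅ i hi
    rwa [show 2 * (n + 1) + i = 2 * n + 2 + i by lia,
      show n + 1 + (n + 3) + i = 2 * n + 4 + i by lia,
      show 2 * (n + 3) + i = 2 * n + 6 + i by lia] at h
  have b0 : T (2 * n + 2) = 0 := by
    simpa [mid (2 * n + 4) (by lia) (by lia), mid (2 * n + 6) (by lia) (by lia)] using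
      sq 0 (by lia)
  have b1 : T (2 * n + 3) = 0 := by
    simpa [mid (2 * n + 4 + 1) (by lia) (by lia), mid (2 * n + 6 + 1) (by lia) (by lia)] using
      sq 1 (by lia)
  have b2 : T (3 * n + 5) = 0 := by
    have h := sq (n - 1) (by lia)
    rw [mid _ (by lia) (by lia), mid _ (by lia) (by lia)] at h
    rw [show 2 * n + 6 + (n - 1) = 3 * n + 5 by lia] at h
    simpa using h
  have b3 : T (3 * n + 6) = 0 := by
    have h := sq n (by lia)
    rw [mid _ (by lia) (by lia), mid _ (by lia) (by lia)] at h
    rw [show 2 * n + 6 + n = 3 * n + 6 by lia] at h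
    simpa using h
  have low : ∀ r ≤ n + 2, T (2 * n + 3 - r) = 0 := by
    intro r
    induction r using Nat.strong_induction_on with
    | _ r ih =>
      intro hr
      match r, ih, hr with
      | 0, _, _ => exact b1
      | 1, _, _ => exact b0
      | r + 2, ih, hr =>
        have h := h₃ (n - r) (by lia)
        have := ih r (by lia) (by lia)
        rw [show 2 * n + 3 - r = n + 3 + (n - r) by lia] at this
        rw [this, add_zero] at h
        rw [← h]; congr 1; lia
  have high : ∀ r ≤ n + 2, T (3 * n + 5 + r) = 0 := by
    intro r
    induction r using Nat.strong_induction_on with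
    | _ r ih =>
      intro hr
      match r, ih, hr with
      | 0, _, _ => exact b2
      | 1, _, _ => exact b3
      | r + 2, ih, hr =>
        have h := h₄ r (by lia)
        have := ih r (by lia) (by lia)
        rw [show 3 * n + 5 + r = 2 * (n + 2) + (n + 1) + r by lia] at this
        rw [this, zero_add] at h
        rw [← h]; congr 1; lia
  intro e he
  by_cases c1 : e ≤ n
  · exact h₀ e c1
  by_cases c2 : e ≤ 2 * n + 3
  · have := low (2 * n + 3 - e) (by lia)
    rwa [show 2 * n + 3 - (2 * n + 3 - e) = e by lia] at this
  by_cases c3 : e ≤ 3 * n + 4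
  · exact mid e (by lia) c3
  by_cases c4 : e ≤ 4 * n + 7
  · have := high (e - (3 * n + 5)) (by lia)
    rwa [show 3 * n + 5 + (e - (3 * n + 5)) = e by lia] at this
  · have := h₂ (e - 2 * (2 * (n + 2))) (by lia)
    rwa [show 2 * (2 * (n + 2)) + (e - 2 * (2 * (n + 2))) = e by lia] at this

universe u in
lemma exists_exponents (d : ℕ) (hodd : Odd d → 5 ≤ d) (heven : Even d → 10 ≤ d) :
    ∃ j a b : ℕ, 2 * j + 2 < d ∧ a ≤ d ∧ b ≤ d ∧
      ∀ {V : Type u} [AddCommGroup V] (T : ℕ → V),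
        (∀ i ≤ j, T i = 0) → (∀ i ≤ j, T (d + i) = 0) → (∀ i ≤ j, T (2 * d + i) = 0) →
        (∀ i ≤ j, T (a + i) + T (b + i) = 0) → (∀ i ≤ j, T (d + a + i) + T (d + b + i) = 0) →
        (∀ i ≤ j, T (2 * a + i) + 2 • T (a + b + i) + T (2 * b + i) = 0) →
        ∀ e ≤ 2 * d + j, T e = 0 := by
  rcases Nat.even_or_odd' d with ⟨m, rfl | rfl⟩
  · have := heven (by simp)
    obtain ⟨n, rfl⟩ : ∃ n, m = n + 2 := ⟨m - 2, by lia⟩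
    exact ⟨n, n + 1, n + 3, by lia, by lia, by lia, fun T h₀ h₁ h₂ h₃ h₄ h₅ =>
      eq_zero_of_relations_even T n (by lia) h₀ h₁ h₂ h₃ h₄ h₅⟩
  · have := hodd (by simp)
    refine ⟨m - 1, m, 2 * m, by lia, by lia, by lia, fun T h₀ h₁ h₂ h₃ h₄ h₅ e he => ?_⟩
    exact eq_zero_of_relations_odd T m (by lia) (fun i hi => h₀ i (by lia))
      (fun i hi => h₁ i (by lia)) (fun i hi => h₂ i (by lia)) (fun i hi => h₃ i (by lia))
      (fun i hi => h₄ i (by lia)) (fun i hi => h₅ i (by lia)) e (by lia)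

section

variable {A : Type*} [CommRing A]

/-- The exponent vector of `x ^ e * y ^ (n - e)`. -/
def expo (n e : ℕ) : Fin 2 →₀ ℕ := Finsupp.single 0 e + Finsupp.single 1 (n - e)

/-- The monomial `x ^ e * y ^ (n - e)`. -/
def mono (A : Type*) [CommRing A] (n e : ℕ) : MvPolynomial (Fin 2) A :=
  X 0 ^ e * X 1 ^ (n - e)

lemma mono_eq_monomial (n e : ℕ) : mono A n e = monomial (expo n e) 1 := by
  simp [mono, expo, X_pow_eq_monomial, monomial_mul]

lemma mono_mul_mono {n e n' e' : ℕ} (h : e ≤ n) (h' : e' ≤ n') :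
    mono A n e * mono A n' e' = mono A (n + n') (e + e') := by
  rw [mono, mono, mono, show n + n' - (e + e') = (n - e) + (n' - e') by lia]
  ring

lemma isHomogeneous_mono {n e : ℕ} (h : e ≤ n) : (mono A n e).IsHomogeneous n := by
  have := ((isHomogeneous_X A (0 : Fin 2)).pow e).mul ((isHomogeneous_X A (1 : Fin 2)).pow (n - e))
  simpa [mono, h] using this

lemma expo_inj {n e e' : ℕ} : expo n e = expo n e' ↔ e = e' := by
  refine ⟨fun h => ?_, fun h => h ▸ rfl⟩
  simpa [expo] using DFunLike.congr_fun h 0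

lemma coeff_mono (n e e' : ℕ) : coeff (expo n e') (mono A n e) = if e = e' then 1 else 0 := by
  rw [mono_eq_monomial, coeff_monomial]
  simp [expo_inj]

lemma eq_sum_mono {n : ℕ} {p : MvPolynomial (Fin 2) A} (hp : p.IsHomogeneous n) :
    p = ∑ e : Fin (n + 1), C (coeff (expo n e) p) * mono A n e := by
  ext s
  simp only [coeff_sum, coeff_C_mul, mono_eq_monomial, coeff_monomial, mul_ite, mul_one, mul_zero]
  by_cases hs : s 0 + s 1 = n
  · have h : s = expo n (s 0) := by
      ext i
      fin_cases i
      · simp [expo]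
      · simp [expo]; lia
    rw [Finset.sum_eq_single (⟨s 0, by lia⟩ : Fin (n + 1))]
    · simp [← h]
    · intro b _ hb
      rw [if_neg]
      rw [h, expo_inj]
      exact fun hh => hb (Fin.ext hh)
    · simp
  · rw [Finset.sum_eq_zero]
    · by_contra h
      have := hp h
      simp [Finsupp.weight_apply, Finsupp.sum_fintype] at this
      exact hs this
    · intro e _
      rw [if_neg]
      rintro rfl
      apply hs
      simp [expo]; lia

/-- The binary form of degree `d` with coefficient vector `c` in a commutative ring. -/
def binaryForm (d : ℕ) (c : Fin (d + 1) → A) : MvPolynomial (Fin 2) A :=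
  ∑ l : Fin (d + 1), C (c l) * mono A d l

lemma formOf_eq_binaryForm {k : Type*} [Field k] (d : ℕ) (c : Fin (d + 1) → k) :
    formOf d c = binaryForm d c := by
  simp only [formOf, binaryForm, mono, mul_assoc]

lemma isHomogeneous_binaryForm (d : ℕ) (c : Fin (d + 1) → A) :
    (binaryForm d c).IsHomogeneous d := by
  refine IsHomogeneous.sum _ _ _ fun l _ => ?_
  simpa using
    (isHomogeneous_C (Fin 2) (c l)).mul (isHomogeneous_mono (A := A) (n := d) (e := l) (by lia))

lemma map_mono {B : Type*} [CommRing B] (φ : A →+* B) (n e : ℕ) :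
    MvPolynomial.map φ (mono A n e) = mono B n e := by
  simp [mono]

lemma map_binaryForm {B : Type*} [CommRing B] (φ : A →+* B) (d : ℕ) (c : Fin (d + 1) → A) :
    MvPolynomial.map φ (binaryForm d c) = binaryForm d (φ ∘ c) := by
  simp [binaryForm, map_mono]

lemma binaryForm_ite (d a : ℕ) (h : a ≤ d) :
    binaryForm d (fun l => if (l : ℕ) = a then (1 : A) else 0) = mono A d a := by
  rw [binaryForm, Finset.sum_eq_single (⟨a, by lia⟩ : Fin (d + 1))]
  · simp
  · intro l _ hl
    rw [if_neg (fun h => hl (Fin.ext h))]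
    simp
  · simp

/-- The product of two of the three binary forms with coefficients `c` and a monomial of
degree `j`. -/
def quadraticProduct (d j : ℕ) (c : Fin 3 → Fin (d + 1) → A) (i : Fin 3 × Fin 3 × Fin (j + 1)) :
    MvPolynomial (Fin 2) A :=
  binaryForm d (c i.1) * binaryForm d (c i.2.1) * mono A j i.2.2

lemma isHomogeneous_quadraticProduct (d j : ℕ) (c : Fin 3 → Fin (d + 1) → A)
    (i : Fin 3 × Fin 3 × Fin (j + 1)) : (quadraticProduct d j c i).IsHomogeneous (2 * d + j) := by
  rw [two_mul]
  exact ((isHomogeneous_binaryForm d _).mul (isHomogeneous_binaryForm d _)).mul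
    (isHomogeneous_mono (by lia))

lemma map_quadraticProduct {B : Type*} [CommRing B] (φ : A →+* B) (d j : ℕ)
    (c : Fin 3 → Fin (d + 1) → A) (i : Fin 3 × Fin 3 × Fin (j + 1)) :
    MvPolynomial.map φ (quadraticProduct d j c i) =
      quadraticProduct d j (fun p l => φ (c p l)) i := by
  simp [quadraticProduct, map_mono, map_binaryForm, Function.comp_def]

/-- If the products of the forms with coefficients `c₀` span all forms of degree `2 * d + j`, then
so do those of general forms. -/
lemma exists_polynomial_of_mono_mem_span {k : Type*} [Field k] (d j : ℕ)
    (c₀ : Fin 3 → Fin (d + 1) → k)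
    (h₀ : ∀ e ≤ 2 * d + j,
      mono k (2 * d + j) e ∈ Submodule.span k (Set.range (quadraticProduct d j c₀))) :
    ∃ P : MvPolynomial (Fin 3 × Fin (d + 1)) k, P ≠ 0 ∧
      ∀ c : Fin 3 → Fin (d + 1) → k, eval (fun p => c p.1 p.2) P ≠ 0 →
        ∀ e ≤ 2 * d + j,
          mono k (2 * d + j) e ∈ Submodule.span k (Set.range (quadraticProduct d j c)) := by
  set n := 2 * d + j
  simp only [Submodule.mem_span_range_iff_exists_fun] at h₀
  have h₀' : ∀ e : Fin (n + 1), ∃ N : Fin 3 × Fin 3 × Fin (j + 1) → k,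
      ∑ i, N i • quadraticProduct d j c₀ i = mono k n e := fun e => h₀ e (by lia)
  choose N hN using h₀'
  let M (c : Fin 3 → Fin (d + 1) → k) : Matrix (Fin (n + 1)) (Fin (n + 1)) k :=
    Matrix.of fun e e' => coeff (expo n e') (∑ i, N e i • quadraticProduct d j c i)
  let U : Fin 3 → Fin (d + 1) → MvPolynomial (Fin 3 × Fin (d + 1)) k := fun p l => X (p, l)
  let Q : Matrix (Fin (n + 1)) (Fin (n + 1)) (MvPolynomial (Fin 3 × Fin (d + 1)) k) :=
    Matrix.of fun e e' => ∑ i, C (N e i) * coeff (expo n e') (quadraticProduct d j U i)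
  have hQ : ∀ c : Fin 3 → Fin (d + 1) → k, eval (fun p => c p.1 p.2) Q.det = (M c).det := by
    intro c
    rw [RingHom.map_det]
    congr 1
    ext e e'
    simp only [Q, M, RingHom.mapMatrix_apply, Matrix.map_apply, Matrix.of_apply, map_sum, map_mul,
      eval_C, coeff_sum, coeff_smul, smul_eq_mul, ← coeff_map, map_quadraticProduct]
    simp [U]
  refine ⟨Q.det, fun h => ?_, fun c hc e he => ?_⟩
  · have h1 : M c₀ = 1 := by
      ext e e'
      simp [M, hN, coeff_mono, Matrix.one_apply, Fin.ext_iff]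
    have := hQ c₀
    simp [h, h1] at this
  · rw [hQ] at hc
    have hu : IsUnit (M c).det := isUnit_iff_ne_zero.mpr hc
    have hG : ∀ e, ∑ i, N e i • quadraticProduct d j c i = ∑ e', M c e e' • mono k n e' := by
      intro e
      conv_lhs => rw [eq_sum_mono (n := n) (p := ∑ i, N e i • quadraticProduct d j c i)
        (IsHomogeneous.sum _ _ _ fun i _ => by
          rw [smul_eq_C_mul]
          simpa using
            (isHomogeneous_C (Fin 2) (N e i)).mul (isHomogeneous_quadraticProduct d j c i))]
      simp only [smul_eq_C_mul, M, Matrix.of_apply]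
    have hm : mono k n e = ∑ e', (M c)⁻¹ ⟨e, by lia⟩ e' • ∑ i, N e' i • quadraticProduct d j c i := by
      simp only [hG, Finset.smul_sum, smul_smul]
      rw [Finset.sum_comm]
      simp only [← Finset.sum_smul, ← Matrix.mul_apply, Matrix.nonsing_inv_mul _ hu,
        Matrix.one_apply, ite_smul, one_smul, zero_smul]
      simp
    rw [hm]
    exact Submodule.sum_mem _ fun e' _ => Submodule.smul_mem _ _ <| Submodule.sum_mem _ fun i _ =>
      Submodule.smul_mem _ _ <| Submodule.subset_span ⟨i, rfl⟩

universe u in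
lemma mono_mem_span_of_exponents {k : Type u} [Field k] {d j a b : ℕ} (ha : a ≤ d) (hb : b ≤ d)
    (h : ∀ {V : Type u} [AddCommGroup V] (T : ℕ → V),
        (∀ i ≤ j, T i = 0) → (∀ i ≤ j, T (d + i) = 0) → (∀ i ≤ j, T (2 * d + i) = 0) →
        (∀ i ≤ j, T (a + i) + T (b + i) = 0) → (∀ i ≤ j, T (d + a + i) + T (d + b + i) = 0) →
        (∀ i ≤ j, T (2 * a + i) + 2 • T (a + b + i) + T (2 * b + i) = 0) →
        ∀ e ≤ 2 * d + j, T e = 0) :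
    ∃ c : Fin 3 → Fin (d + 1) → k, ∀ e ≤ 2 * d + j,
      mono k (2 * d + j) e ∈ Submodule.span k (Set.range (quadraticProduct d j c)) := by
  let δ (r : ℕ) : Fin (d + 1) → k := fun l => if (l : ℕ) = r then 1 else 0
  let c : Fin 3 → Fin (d + 1) → k := ![δ 0, δ d, fun l => δ a l + δ b l]
  refine ⟨c, ?_⟩
  set W := Submodule.span k (Set.range (quadraticProduct d j c))
  have f0 : binaryForm d (c 0) = mono k d 0 := binaryForm_ite d 0 (by lia)
  have f1 : binaryForm d (c 1) = mono k d d := binaryForm_ite d d le_rfl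
  have f2 : binaryForm d (c 2) = mono k d a + mono k d b := by
    rw [← binaryForm_ite d a ha, ← binaryForm_ite d b hb]
    simp [binaryForm, c, δ, add_mul, Finset.sum_add_distrib]
  have key : ∀ p q (i : ℕ), i ≤ j →
      W.mkQ (binaryForm d (c p) * binaryForm d (c q) * mono k j i) = 0 := fun p q i hi =>
    (Submodule.Quotient.mk_eq_zero W).mpr <|
      Submodule.subset_span ⟨(p, q, ⟨i, by lia⟩), rfl⟩
  have mul3 : ∀ r s i : ℕ, r ≤ d → s ≤ d → i ≤ j →
      mono k d r * mono k d s * mono k j i = mono k (2 * d + j) (r + s + i) := by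
    intro r s i hr hs hi
    rw [mono_mul_mono hr hs, mono_mul_mono (by lia) hi, two_mul]
  intro e he
  refine (Submodule.Quotient.mk_eq_zero W).mp
    (h (fun e => W.mkQ (mono k (2 * d + j) e)) ?_ ?_ ?_ ?_ ?_ ?_ e he) <;> intro i hi
  · have := key 0 0 i hi
    rwa [f0, mul3 _ _ _ (by lia) (by lia) hi, zero_add, zero_add] at this
  · have := key 0 1 i hi
    rwa [f0, f1, mul3 _ _ _ (by lia) (by lia) hi, zero_add] at this
  · have := key 1 1 i hi
    rwa [f1, mul3 _ _ _ (by lia) (by lia) hi, ← two_mul] at this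
  · have := key 0 2 i hi
    rwa [f0, f2, mul_add, add_mul, mul3 _ _ _ (by lia) ha hi, mul3 _ _ _ (by lia) hb hi, zero_add,
      zero_add, map_add] at this
  · have := key 1 2 i hi
    rwa [f1, f2, mul_add, add_mul, mul3 _ _ _ (by lia) ha hi, mul3 _ _ _ (by lia) hb hi,
      map_add] at this
  · have := key 2 2 i hi
    have e1 : (mono k d a + mono k d b) * (mono k d a + mono k d b) * mono k j i =
      mono k d a * mono k d a * mono k j i + 2 • (mono k d a * mono k d b * mono k j i) +
        mono k d b * mono k d b * mono k j i := by
      rw [two_smul]; ring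
    rwa [f2, e1, mul3 _ _ _ ha ha hi, mul3 _ _ _ ha hb hi, mul3 _ _ _ hb hb hi,
      map_add, map_add, map_nsmul, ← two_mul, ← two_mul] at this

lemma homogeneousComponent_mul_of_isHomogeneous_s9 {σ : Type*} {p q : MvPolynomial σ A} {m n : ℕ}
    (hq : q.IsHomogeneous n) :
    homogeneousComponent (m + n) (p * q) = homogeneousComponent m p * q := by
  let _ := MvPolynomial.gradedAlgebra (σ := σ) (R := A)
  have h := DirectSum.coe_decompose_mul_add_of_right_mem (homogeneousSubmodule σ A)
    (i := m) (a := p) ((mem_homogeneousSubmodule n q).mpr hq)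
  exact (decomposition.decompose'_apply _ _).symm.trans (h.trans
    (congrArg (· * q) (decomposition.decompose'_apply _ _)))

/-- By a dimension count, few forms of degree `d` do not generate all forms of degree `d + j`. -/
lemma exists_mono_notMem_span_range {k : Type*} [Field k] {ι : Type*} [Fintype ι] {d j : ℕ}
    (f : ι → MvPolynomial (Fin 2) k) (hf : ∀ p, (f p).IsHomogeneous d)
    (hj : Fintype.card ι * (j + 1) < d + j + 1) :
    ∃ e ≤ d + j, mono k (d + j) e ∉ Ideal.span (Set.range f) := by
  by_contra! h
  have h' : ∀ e ≤ j + d, mono k (j + d) e ∈ Ideal.span (Set.range f) := by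
    rwa [add_comm j d]
  let L : (ι × Fin (j + 1) → k) →ₗ[k] (Fin (j + d + 1) → k) :=
    ∑ x : ι × Fin (j + 1), (LinearMap.pi fun e : Fin (j + d + 1) =>
      lcoeff k (expo (j + d) e) ∘ₗ LinearMap.toSpanSingleton k _ (mono k j x.2 * f x.1)) ∘ₗ
        LinearMap.proj x
  have hL : ∀ u e, L u e = coeff (expo (j + d) e) (∑ x, u x • (mono k j x.2 * f x.1)) := by
    intro u e
    simp [L, coeff_sum]
  have hsurj : Function.Surjective L := by
    intro t
    have ht : ∑ e : Fin (j + d + 1), t e • mono k (j + d) e ∈ Ideal.span (Set.range f) := by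
      refine Ideal.sum_mem _ fun e _ => ?_
      rw [smul_eq_C_mul]
      exact Ideal.mul_mem_left _ _ (h' e (by lia))
    obtain ⟨r, hr⟩ := Ideal.mem_span_range_iff_exists_fun.mp ht
    refine ⟨fun x => coeff (expo j x.2) (homogeneousComponent j (r x.1)), ?_⟩
    have hh : (∑ e : Fin (j + d + 1), t e • mono k (j + d) e).IsHomogeneous (j + d) :=
      IsHomogeneous.sum _ _ _ fun e _ => by
        rw [smul_eq_C_mul]
        simpa using (isHomogeneous_C (Fin 2) (t e)).mul
          (isHomogeneous_mono (A := k) (n := j + d) (e := e) (by lia))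
    have h1 := congrArg (homogeneousComponent (j + d)) hr
    rw [homogeneousComponent_eq_self hh, map_sum] at h1
    simp only [homogeneousComponent_mul_of_isHomogeneous_s9 (hf _)] at h1
    have h2 : ∑ x : ι × Fin (j + 1), coeff (expo j x.2) (homogeneousComponent j (r x.1)) •
        (mono k j x.2 * f x.1) = ∑ e : Fin (j + d + 1), t e • mono k (j + d) e := by
      rw [← h1, Fintype.sum_prod_type]
      refine Finset.sum_congr rfl fun p _ => ?_
      conv_rhs => rw [eq_sum_mono (homogeneousComponent_isHomogeneous j (r p))]
      simp only [Finset.sum_mul, smul_eq_C_mul, mul_assoc]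
    ext e
    rw [hL, h2]
    simp [coeff_sum, coeff_mono, Fin.val_inj]
  have := LinearMap.finrank_le_finrank_of_surjective hsurj
  simp at this
  lia

lemma height_eq_two_of_X_mem {k : Type*} [Field k] (P : PrimeSpectrum (MvPolynomial (Fin 2) k))
    (hX : ∀ i, X i ∈ P.asIdeal) : Order.height P = 2 := by
  apply le_antisymm
  · rw [← PrimeSpectrum.height_eq_orderHeight]
    have h1 := Ideal.height_le_ringKrullDim_of_ne_top P.2.ne_top
    have h2 : ringKrullDim (MvPolynomial (Fin 2) k) = 2 := by
      rw [MvPolynomial.ringKrullDim_of_isNoetherianRing]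
      simp
    rw [h2] at h1
    exact WithBot.coe_le_coe.mp h1
  · let φ : MvPolynomial (Fin 2) k →ₐ[k] MvPolynomial (Fin 2) k := aeval ![0, X 1]
    let Q : PrimeSpectrum (MvPolynomial (Fin 2) k) := ⟨RingHom.ker φ, RingHom.ker_isPrime _⟩
    let Z : PrimeSpectrum (MvPolynomial (Fin 2) k) := ⟨⊥, Ideal.isPrime_bot⟩
    have hZQ : Z < Q := by
      refine lt_of_le_of_ne (show (⊥ : Ideal _) ≤ _ from bot_le) fun h => ?_
      have h0 : (X 0 : MvPolynomial (Fin 2) k) ∈ Q.asIdeal := by simp [Q, φ, RingHom.mem_ker]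
      rw [← h] at h0
      exact X_ne_zero _ h0
    have hQP : Q < P := by
      refine lt_of_le_of_ne (show Q.asIdeal ≤ P.asIdeal from fun p hp => ?_) fun h => ?_
      · have hφ : (Ideal.Quotient.mk P.asIdeal).comp φ.toRingHom = Ideal.Quotient.mk P.asIdeal := by
          refine ringHom_ext (fun r => by simp [φ]) fun i => ?_
          fin_cases i
          · simpa [φ] using (Ideal.Quotient.eq_zero_iff_mem.mpr (hX 0)).symm
          · simp [φ]
        rw [← Ideal.Quotient.eq_zero_iff_mem, ← hφ]
        have hp' : φ p = 0 := hp
        simp [hp']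
      · have h0 := hX 1
        rw [← h] at h0
        exact X_ne_zero (R := k) (1 : Fin 2) (by simp [Q, φ, RingHom.mem_ker] at h0)
    have h1 := Order.height_add_one_le hZQ
    have h2 := Order.height_add_one_le hQP
    calc (2 : ℕ∞) = 0 + 1 + 1 := by norm_num
      _ ≤ Order.height Z + 1 + 1 := by gcongr; exact zero_le
      _ ≤ _ := (by gcongr : _ ≤ Order.height Q + 1).trans h2

lemma idealHeight_eq_two_s9 {k : Type*} [Field k] {d n : ℕ} (hd : 0 < d) {ι : Type*}
    (f : ι → MvPolynomial (Fin 2) k) (hf : ∀ p, (f p).IsHomogeneous d)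
    (hn : ∀ e ≤ n, mono k n e ∈ Ideal.span (Set.range f)) :
    idealHeight (Ideal.span (Set.range f)) = 2 := by
  apply le_antisymm
  · let P : PrimeSpectrum (MvPolynomial (Fin 2) k) :=
      ⟨RingHom.ker (constantCoeff (σ := Fin 2) (R := k)), RingHom.ker_isPrime _⟩
    have hP : Ideal.span (Set.range f) ≤ P.asIdeal := by
      rw [Ideal.span_le]
      rintro _ ⟨p, rfl⟩
      rw [SetLike.mem_coe, RingHom.mem_ker, constantCoeff_eq]
      exact (hf p).coeff_eq_zero (by simpa using hd.ne)
    refine (iInf₂_le P hP).trans (height_eq_two_of_X_mem P fun i => ?_).le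
    simp [P, RingHom.mem_ker]
  · refine le_iInf₂ fun P hP => (height_eq_two_of_X_mem P fun i => ?_).ge
    fin_cases i
    · exact P.2.mem_of_pow_mem n (by simpa [mono] using hP (hn n le_rfl))
    · exact P.2.mem_of_pow_mem n (by simpa [mono] using hP (hn 0 (by lia)))

lemma mono_mem_colon {k : Type*} [Field k] {d j : ℕ} (c : Fin 3 → Fin (d + 1) → k)
    {J : Ideal (MvPolynomial (Fin 2) k)} (hJ : ∀ e ≤ 2 * d + j, mono k (2 * d + j) e ∈ J)
    {e : ℕ} (he : e ≤ d + j) :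
    mono k (d + j) e ∈ Submodule.colon J
      (Ideal.span (Set.range fun p => binaryForm d (c p)) : Set (MvPolynomial (Fin 2) k)) := by
  rw [Submodule.mem_colon]
  intro s hs
  induction hs using Submodule.span_induction with
  | mem x hx =>
    obtain ⟨p, rfl⟩ := hx
    simp only [binaryForm, smul_eq_mul, Finset.mul_sum]
    refine Ideal.sum_mem _ fun l _ => ?_
    rw [mul_left_comm, mono_mul_mono he (by lia), show d + j + d = 2 * d + j by lia]
    exact Ideal.mul_mem_left _ _ (hJ _ (by lia))
  | zero => simp
  | add x y _ _ hx hy => rw [smul_add]; exact J.add_mem hx hy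
  | smul r x _ hx => rw [smul_comm]; exact J.smul_mem r hx

lemma quadraticProduct_mem_sq {k : Type*} [Field k] (d j : ℕ) (c : Fin 3 → Fin (d + 1) → k)
    (i : Fin 3 × Fin 3 × Fin (j + 1)) :
    quadraticProduct d j c i ∈ Ideal.span (Set.range fun p => binaryForm d (c p)) ^ 2 := by
  rw [sq]
  exact Ideal.mul_mem_right _ _ (Ideal.mul_mem_mul (Ideal.subset_span ⟨i.1, rfl⟩)
    (Ideal.subset_span ⟨i.2.1, rfl⟩))

end

/-- For an infinite field `k` of characteristic ≠ 2 and `d ≥ 5` if `d` is odd,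
respectively `d ≥ 10` if `d` is even, for general forms `f₁, f₂, f₃` of degree `d` in
`R = k[x,y]` (genericity encoded as the nonvanishing locus of a nonzero polynomial on
the parameter space `k^{3(d+1)}`), with `I = (f₁,f₂,f₃)` (which has codimension 2),
the colon ideal `I² : I` is not contained in `I`; in particular `I² : I ≠ I`. -/
theorem general_binary_forms_colon_not_contained (k : Type*) [Field k] [Infinite k]
    (h2 : (2 : k) ≠ 0) (d : ℕ) (hodd : Odd d → 5 ≤ d) (heven : Even d → 10 ≤ d) :
    ∃ P : MvPolynomial (Fin 3 × Fin (d + 1)) k, P ≠ 0 ∧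
      ∀ c : Fin 3 → Fin (d + 1) → k,
        eval (fun p => c p.1 p.2) P ≠ 0 →
          idealHeight (Ideal.span {formOf d (c 0), formOf d (c 1), formOf d (c 2)}) = 2 ∧
          ¬ (Submodule.colon
                ((Ideal.span {formOf d (c 0), formOf d (c 1), formOf d (c 2)}) ^ 2)
                (Ideal.span {formOf d (c 0), formOf d (c 1), formOf d (c 2)}) ≤
              Ideal.span {formOf d (c 0), formOf d (c 1), formOf d (c 2)}) ∧
          Submodule.colon
              ((Ideal.span {formOf d (c 0), formOf d (c 1), formOf d (c 2)}) ^ 2)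
              (Ideal.span {formOf d (c 0), formOf d (c 1), formOf d (c 2)}) ≠
            Ideal.span {formOf d (c 0), formOf d (c 1), formOf d (c 2)} := by
  obtain ⟨j, a, b, hj, ha, hb, h⟩ := exists_exponents d hodd heven
  obtain ⟨c₀, hc₀⟩ := mono_mem_span_of_exponents (k := k) ha hb h
  obtain ⟨P, hP, hc⟩ := exists_polynomial_of_mono_mem_span d j c₀ hc₀
  refine ⟨P, hP, fun c hPc => ?_⟩
  have hI : Ideal.span {formOf d (c 0), formOf d (c 1), formOf d (c 2)} =
      Ideal.span (Set.range fun p => binaryForm d (c p)) := by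
    congr 1
    ext x
    simp [formOf_eq_binaryForm, Fin.exists_fin_succ, eq_comm]
  rw [hI]
  set f := fun p => binaryForm d (c p)
  have hf : ∀ p, (f p).IsHomogeneous d := fun p => isHomogeneous_binaryForm d (c p)
  have hle : Submodule.span k (Set.range (quadraticProduct d j c)) ≤
      (Ideal.span (Set.range f) ^ 2).restrictScalars k := by
    rw [Submodule.span_le]
    rintro _ ⟨i, rfl⟩
    exact quadraticProduct_mem_sq d j c i
  have hJ : ∀ e ≤ 2 * d + j, mono k (2 * d + j) e ∈ Ideal.span (Set.range f) ^ 2 := fun e he =>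
    (Submodule.restrictScalars_mem k _ _).mp (hle (hc c hPc e he))
  obtain ⟨e, he, hmem⟩ := exists_mono_notMem_span_range (j := j) f hf (by simp; lia)
  have hcolon : ¬ Submodule.colon (Ideal.span (Set.range f) ^ 2)
      (Ideal.span (Set.range f) : Set (MvPolynomial (Fin 2) k)) ≤ Ideal.span (Set.range f) :=
    fun hle => hmem (hle (mono_mem_colon c hJ he))
  exact ⟨idealHeight_eq_two_s9 (by lia) f hf fun e he => Ideal.pow_le_self two_ne_zero (hJ e he),
    hcolon, fun heq => hcolon heq.le⟩
end
end
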